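/- arXiv:2108.08517 — 4 statements merged into one kernel-verified Lean document; each statement's English description precedes it below -/
import Mathlib

section
/- Let n ≥ 3, m ≥ 1, and let B₁, …, Bₘ be real symmetric n×n matrices such that each Bᵢ is a real linear combination of three fixed real symmetric n×n matrices A₁, A₂, A₃, where s₁A₁ + s₂A₂ + s₃A₃ is positive definite for some s ∈ ℝ³. Then the set {(xᵀB₁x, …, xᵀBₘx) : x ∈ ℝⁿ} is a convex cone in ℝᵐ. -/
open Matrix

/-- Two vectors `u`, `v` orthogonal to `N ≠ 0` are parallel if `u` is also orthogonal to
`N ⨯₃ v`. -/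
theorem cross_eq_zero_of_dotProduct_eq_zero {N u v : Fin 3 → ℝ} (hN : N ≠ 0)
    (hu : N ⬝ᵥ u = 0) (hv : N ⬝ᵥ v = 0) (huv : (N ⨯₃ v) ⬝ᵥ u = 0) : u ⨯₃ v = 0 := by
  have hNN : N ⬝ᵥ N ≠ 0 := fun h => hN (dotProduct_self_eq_zero.1 h)
  refine (smul_eq_zero.1 (?_ : (N ⬝ᵥ N) • (u ⨯₃ v) = 0)).resolve_left hNN
  simp only [cross_apply, dotProduct, Fin.sum_univ_three, cons_val] at hu hv huv
  ext j
  simp only [cross_apply, dotProduct, Fin.sum_univ_three, Pi.smul_apply, smul_eq_mul,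
    Pi.zero_apply]
  fin_cases j <;> simp only [Fin.reduceFinMk, Fin.zero_eta, Fin.isValue, Fin.mk_one, cons_val]
  · linear_combination (-N 0) * huv + (N 1 * v 2 - N 2 * v 1) * hu +
      (N 2 * u 1 - N 1 * u 2) * hv
  · linear_combination (-N 1) * huv + (N 2 * v 0 - N 0 * v 2) * hu +
      (N 0 * u 2 - N 2 * u 0) * hv
  · linear_combination (-N 2) * huv + (N 0 * v 1 - N 1 * v 0) * hu +
      (N 1 * u 0 - N 0 * u 1) * hv

namespace LinearMap.BilinForm

variable {V : Type*} [AddCommGroup V] [Module ℝ V]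

/-- A quadratic form which changes sign between two isotropic vectors `x`, `y` of `H` that are
`H`-orthogonal has a nontrivial zero which is again isotropic for `H`. -/
theorem exists_ne_zero_isotropic_of_orthogonal {H G : LinearMap.BilinForm ℝ V} {x y : V}
    (hx : H x x = 0) (hy : H y y = 0) (hxy : H x y = 0) (hyx : H y x = 0)
    (gx : G x x < 0) (gy : 0 < G y y) :
    ∃ z ≠ 0, H z z = 0 ∧ G z z = 0 := by
  have key : ∀ t : ℝ, G ((1 - t) • x + t • y) ((1 - t) • x + t • y) =
      (1 - t) ^ 2 * G x x + (1 - t) * t * (G x y + G y x) + t ^ 2 * G y y := by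
    intro t
    simp only [map_add, map_smul, LinearMap.add_apply, LinearMap.smul_apply, smul_eq_mul]
    ring
  have hcont : Continuous fun t : ℝ => G ((1 - t) • x + t • y) ((1 - t) • x + t • y) := by
    simp only [key]
    fun_prop
  obtain ⟨t, -, ht⟩ := intermediate_value_Icc zero_le_one hcont.continuousOn
    (show (0 : ℝ) ∈ Set.Icc _ _ by simp [gx.le, gy.le])
  refine ⟨(1 - t) • x + t • y, fun h0 => ?_, by simp [hx, hy, hxy, hyx], ht⟩
  have h1 : (1 - t) • x = -(t • y) := eq_neg_of_add_eq_zero_left h0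
  have h2 : (1 - t) ^ 2 * G x x = t ^ 2 * G y y := by
    have := congrArg (fun v => G v v) h1
    simp only [map_smul, map_neg, LinearMap.neg_apply, LinearMap.smul_apply, smul_eq_mul] at this
    linarith
  have ht0 : t = 0 := by
    by_contra hne
    have : 0 < t ^ 2 * G y y := by positivity
    nlinarith [sq_nonneg (1 - t)]
  subst ht0
  norm_num at h2
  exact gx.ne h2

/-- In dimension at least three, a quadratic form which changes sign on the isotropic vectors of a
symmetric bilinear form `H` has a nontrivial isotropic zero. -/
theorem exists_ne_zero_isotropic [FiniteDimensional ℝ V] (hV : 3 ≤ Module.finrank ℝ V)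
    {H G : LinearMap.BilinForm ℝ V} (hH : ∀ u v, H u v = H v u) {x y : V}
    (hx : H x x = 0) (hy : H y y = 0) (gx : G x x < 0) (gy : 0 < G y y) :
    ∃ z ≠ 0, H z z = 0 ∧ G z z = 0 := by
  by_cases hxy : H x y = 0
  · exact exists_ne_zero_isotropic_of_orthogonal hx hy hxy (hH y x ▸ hxy) gx gy
  obtain ⟨w, hw, hw0⟩ := Submodule.exists_mem_ne_zero_of_ne_bot
    (LinearMap.ker_ne_bot_of_finrank_lt (f := (H x).prod (H y))
      (by simp only [Module.finrank_prod, Module.finrank_self]; lia))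
  obtain ⟨hxw, hyw⟩ : H x w = 0 ∧ H y w = 0 := by simpa using hw
  have hwx : H w x = 0 := hH w x ▸ hxw
  have hwy : H w y = 0 := hH w y ▸ hyw
  by_cases hww : H w w = 0
  · rcases lt_trichotomy (G w w) 0 with h | h | h
    · exact exists_ne_zero_isotropic_of_orthogonal hww hy hwy hyw h gy
    · exact ⟨w, hw0, hww, h⟩
    · exact exists_ne_zero_isotropic_of_orthogonal hx hww hxw hwx gx h
  -- after changing the sign of `y`, `x` and `y` are joined by a conic in the span of `x, y, w`
  obtain ⟨e, he, hb⟩ : ∃ e : ℝ, e ^ 2 = 1 ∧ 0 ≤ -2 * (e * H x y) / H w w := by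
    rcases le_total 0 (-2 * H x y / H w w) with h | h
    · exact ⟨1, by norm_num, by simpa using h⟩
    · refine ⟨-1, by norm_num, ?_⟩
      have : -2 * (-1 * H x y) / H w w = -(-2 * H x y / H w w) := by ring
      rw [this]
      exact neg_nonneg.2 h
  obtain ⟨k, hk⟩ : ∃ k : ℝ, k ^ 2 * H w w = -2 * (e * H x y) :=
    ⟨√(-2 * (e * H x y) / H w w), by rw [Real.sq_sqrt hb]; field_simp⟩
  have he0 : e ≠ 0 := by rintro rfl; norm_num at he
  let c : ℝ → V := fun t => (1 - t) ^ 2 • x + (t ^ 2 * e) • y + (k * t * (1 - t)) • w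
  have hcont : Continuous fun t : ℝ => G (c t) (c t) := by
    simp only [c, map_add, map_smul, LinearMap.add_apply, LinearMap.smul_apply, smul_eq_mul]
    fun_prop
  have h0 : G (c 0) (c 0) = G x x := by simp [c]
  have h1 : G (c 1) (c 1) = G y y := by
    simp only [c, sub_self, map_add, map_smul, LinearMap.add_apply, LinearMap.smul_apply,
      smul_eq_mul]
    linear_combination G y y * he
  obtain ⟨t, -, ht⟩ := intermediate_value_Icc zero_le_one hcont.continuousOn
    (show (0 : ℝ) ∈ Set.Icc _ _ by simp only [h0, h1]; exact ⟨gx.le, gy.le⟩)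
  refine ⟨c t, fun hc => ?_, ?_, ht⟩
  · have hcx : H x (c t) = t ^ 2 * e * H x y := by simp [c, hx, hxw]
    have hcy : H y (c t) = (1 - t) ^ 2 * H x y := by simp [c, hy, hyw, hH y x]
    rw [hc, map_zero] at hcx hcy
    have ht0 : t = 0 := by simpa [he0, hxy] using hcx.symm
    subst ht0
    norm_num at hcy
    exact hxy hcy.symm
  · simp only [c, map_add, map_smul, LinearMap.add_apply, LinearMap.smul_apply, smul_eq_mul,
      hx, hy, hxw, hyw, hwx, hwy, hH y x]
    linear_combination t ^ 2 * (1 - t) ^ 2 * hk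

/-- **Polyak's theorem**: the joint range of three quadratic forms on a real space of dimension at
least three, some linear combination of which is positive definite, is closed under addition. -/
theorem exists_apply_self_eq_add [FiniteDimensional ℝ V] (hV : 3 ≤ Module.finrank ℝ V)
    {F : Fin 3 → LinearMap.BilinForm ℝ V} (hF : ∀ j u v, F j u v = F j v u) {s : Fin 3 → ℝ}
    (hs : ∀ z ≠ 0, 0 < ∑ j, s j * F j z z) (x y : V) :
    ∃ z, ∀ j, F j z z = F j x x + F j y y := by
  by_cases hx0 : x = 0
  · exact ⟨y, by simp [hx0]⟩
  by_cases hy0 : y = 0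
  · exact ⟨x, by simp [hy0]⟩
  let a : V → Fin 3 → ℝ := fun z j => F j z z
  have hpos : ∀ z ≠ 0, 0 < s ⬝ᵥ a z := hs
  have hsum : 0 < s ⬝ᵥ (a x + a y) := by
    rw [dotProduct_add]
    exact add_pos (hpos x hx0) (hpos y hy0)
  -- it suffices to hit the ray through `a x + a y`
  suffices h : ∃ z ≠ 0, a z ⨯₃ (a x + a y) = 0 by
    obtain ⟨z, hz0, hz⟩ := h
    have hr : 0 ≤ s ⬝ᵥ (a x + a y) / s ⬝ᵥ a z := (div_pos hsum (hpos z hz0)).le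
    refine ⟨√(s ⬝ᵥ (a x + a y) / s ⬝ᵥ a z) • z, fun j => ?_⟩
    have h1 : s ⬝ᵥ (a x + a y) * a z j = s ⬝ᵥ a z * (a x + a y) j := by
      have e0 := congrFun hz 0
      have e1 := congrFun hz 1
      have e2 := congrFun hz 2
      simp only [cross_apply, Pi.zero_apply, cons_val] at e0 e1 e2
      simp only [dotProduct, Fin.sum_univ_three]
      fin_cases j <;> simp only [Fin.reduceFinMk, Fin.zero_eta, Fin.isValue, Fin.mk_one]
      · linear_combination s 1 * e2 - s 2 * e1
      · linear_combination s 2 * e0 - s 0 * e2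
      · linear_combination s 0 * e1 - s 1 * e0
    simp only [map_smul, LinearMap.smul_apply, smul_eq_mul]
    rw [← mul_assoc, Real.mul_self_sqrt hr, div_mul_eq_mul_div,
      div_eq_iff (hpos z hz0).ne', mul_comm (F j x x + F j y y)]
    exact h1
  let N := a x ⨯₃ a y
  by_cases hN : N = 0
  · refine ⟨x, hx0, ?_⟩
    rw [map_add, cross_self, zero_add]
    exact hN
  have hNN : 0 < N ⬝ᵥ N := by simpa using dotProduct_self_star_pos_iff.2 hN
  let W := N ⨯₃ (a x + a y)
  have happ : ∀ (u : Fin 3 → ℝ) (z : V), (∑ j, u j • F j) z z = u ⬝ᵥ a z := by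
    intro u z
    simp [LinearMap.sum_apply, dotProduct, a]
  have hWx : W ⬝ᵥ a x = -(N ⬝ᵥ N) := by
    simp only [W, N, cross_apply, dotProduct, Fin.sum_univ_three, cons_val, Pi.add_apply]
    ring
  have hWy : W ⬝ᵥ a y = N ⬝ᵥ N := by
    simp only [W, N, cross_apply, dotProduct, Fin.sum_univ_three, cons_val, Pi.add_apply]
    ring
  obtain ⟨z, hz0, hz1, hz2⟩ := exists_ne_zero_isotropic hV
    (H := ∑ j, N j • F j) (G := ∑ j, W j • F j) (x := x) (y := y)
    (fun u v => by simp [LinearMap.sum_apply, hF _ u v])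
    (by rw [happ, dotProduct_comm]; exact dot_self_cross _ _)
    (by rw [happ, dotProduct_comm]; exact dot_cross_self _ _)
    (by rw [happ, hWx]; linarith) (by rw [happ, hWy]; exact hNN)
  rw [happ] at hz1 hz2
  refine ⟨z, hz0, ?_⟩
  have hNs : N ⬝ᵥ (a x + a y) = 0 := by
    simp only [N, cross_apply, dotProduct, Fin.sum_univ_three, cons_val, Pi.add_apply]
    ring
  exact cross_eq_zero_of_dotProduct_eq_zero hN hz1 hNs hz2

end LinearMap.BilinForm

theorem extended_polyak (n m : ℕ) (hn : 3 ≤ n) (hm : 1 ≤ m)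
    (B : Fin m → Matrix (Fin n) (Fin n) ℝ)
    (A : Fin 3 → Matrix (Fin n) (Fin n) ℝ)
    (hBsym : ∀ i, (B i).IsSymm) (hAsym : ∀ j, (A j).IsSymm)
    (hgen : ∀ i, ∃ r : Fin 3 → ℝ, B i = ∑ j, r j • A j)
    (hs : ∃ s : Fin 3 → ℝ, (∑ j, s j • A j).PosDef) :
    Convex ℝ {y : Fin m → ℝ | ∃ x : Fin n → ℝ, y = fun i => x ⬝ᵥ (B i) *ᵥ x} ∧
    ∀ y ∈ {y : Fin m → ℝ | ∃ x : Fin n → ℝ, y = fun i => x ⬝ᵥ (B i) *ᵥ x},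
      ∀ c : ℝ, 0 ≤ c →
        c • y ∈ {y : Fin m → ℝ | ∃ x : Fin n → ℝ, y = fun i => x ⬝ᵥ (B i) *ᵥ x} := by
  have hcone : ∀ y ∈ {y : Fin m → ℝ | ∃ x : Fin n → ℝ, y = fun i => x ⬝ᵥ (B i) *ᵥ x},
      ∀ c : ℝ, 0 ≤ c →
        c • y ∈ {y : Fin m → ℝ | ∃ x : Fin n → ℝ, y = fun i => x ⬝ᵥ (B i) *ᵥ x} := by
    rintro _ ⟨x, rfl⟩ c hc
    refine ⟨√c • x, funext fun i => ?_⟩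
    simp only [Pi.smul_apply, mulVec_smul, dotProduct_smul, smul_dotProduct, smul_eq_mul]
    rw [← mul_assoc, Real.mul_self_sqrt hc]
  refine ⟨?_, hcone⟩
  have hadd : ∀ x y : Fin n → ℝ, ∃ z : Fin n → ℝ,
      ∀ i, z ⬝ᵥ B i *ᵥ z = x ⬝ᵥ B i *ᵥ x + y ⬝ᵥ B i *ᵥ y := by
    intro x y
    obtain ⟨s, hs⟩ := hs
    have hsum : ∀ (r : Fin 3 → ℝ) (z : Fin n → ℝ),
        z ⬝ᵥ (∑ j, r j • A j) *ᵥ z = ∑ j, r j * (z ⬝ᵥ A j *ᵥ z) := by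
      intro r z
      simp [sum_mulVec, dotProduct_sum, smul_mulVec, dotProduct_smul]
    obtain ⟨z, hz⟩ := LinearMap.BilinForm.exists_apply_self_eq_add (V := Fin n → ℝ)
      (by simpa using hn) (F := fun j => Matrix.toBilin' (A j)) (s := s)
      (fun j u v => by
        rw [Matrix.toBilin'_apply', Matrix.toBilin'_apply', dotProduct_mulVec, dotProduct_comm,
          ← mulVec_transpose, (hAsym j).eq])
      (fun z hz => by
        simp only [Matrix.toBilin'_apply', ← hsum]
        simpa using hs.dotProduct_mulVec_pos hz) x y
    simp only [Matrix.toBilin'_apply'] at hz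
    refine ⟨z, fun i => ?_⟩
    obtain ⟨r, hr⟩ := hgen i
    simp only [hr, hsum, hz, mul_add, Finset.sum_add_distrib]
  intro u hu v hv α β hα hβ _
  obtain ⟨x, hx⟩ := hcone u hu α hα
  obtain ⟨y, hy⟩ := hcone v hv β hβ
  obtain ⟨z, hz⟩ := hadd x y
  exact ⟨z, by rw [hx, hy]; exact funext fun i => (hz i).symm⟩
end

section
/- Let n ≥ 3, m ≥ 1, and let B₀, B₁, …, Bₘ be real symmetric n×n matrices, each a real linear combination of symmetric matrices A₁, A₂, A₃ with s₁A₁ + s₂A₂ + s₃A₃ positive definite for some s ∈ ℝ³. Let β₀, …, βₘ ∈ ℝ and suppose there exists x̄ ∈ ℝⁿ with x̄ᵀBᵢx̄ < βᵢ for i = 1, …, m. Then the implication (for all x ∈ ℝⁿ: xᵀBᵢx ≤ βᵢ for i = 1,…,m ⟹ xᵀB₀x ≥ β₀) holds if and only if there exists t ∈ ℝ₊ᵐ such that B₀ + Σᵢ tᵢBᵢ is positive semidefinite and β₀ + Σᵢ tᵢβᵢ ≤ 0. -/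
open Matrix

section CommonZeros

variable {V : Type*} [AddCommGroup V] [Module ℝ V]

/-- If `C` vanishes identically on a plane and `L` changes sign on it, then `C` and `L` have a
common nontrivial zero in this plane. -/
lemma exists_ne_zero_common_zero_of_isotropic_plane (C L : LinearMap.BilinForm ℝ V) {u v : V}
    (huv : LinearIndependent ℝ ![u, v]) (hu : C u u = 0) (hv : C v v = 0) (hc : C u v = 0)
    (hc' : C v u = 0) (hLu : L u u ≤ 0) (hLv : 0 ≤ L v v) :
    ∃ w ≠ 0, C w w = 0 ∧ L w w = 0 := by
  have hcont : Continuous fun t : ℝ => L ((1 - t) • u + t • v) ((1 - t) • u + t • v) := by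
    simp only [map_add, map_smul, LinearMap.add_apply, LinearMap.smul_apply, smul_eq_mul]
    fun_prop
  obtain ⟨t, ht⟩ := mem_range_of_exists_le_of_exists_ge hcont (c := 0)
    ⟨0, by simpa using hLu⟩ ⟨1, by simpa using hLv⟩
  refine ⟨_, fun h => ?_, ?_, ht⟩
  · have := LinearIndependent.pair_iff.1 huv _ _ h
    linarith [this.1, this.2]
  · simp [hu, hv, hc, hc']

/-- Two symmetric bilinear forms on a space of dimension at least three have a common nontrivial
zero as soon as one of them changes sign between two independent isotropic vectors of the other. -/
lemma exists_ne_zero_common_zero (C L : LinearMap.BilinForm ℝ V) (hC : ∀ u v, C u v = C v u)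
    (hV : 3 ≤ Module.finrank ℝ V) {x y : V} (hxy : LinearIndependent ℝ ![x, y])
    (hx : C x x = 0) (hy : C y y = 0) (hLx : L x x ≤ 0) (hLy : 0 ≤ L y y) :
    ∃ w ≠ 0, C w w = 0 ∧ L w w = 0 := by
  by_cases hc : C x y = 0
  · exact exists_ne_zero_common_zero_of_isotropic_plane C L hxy hx hy hc (hC x y ▸ hc) hLx hLy
  have hspan : Submodule.span ℝ {x, y} ≠ ⊤ := by
    classical
    intro h
    have h1 := finrank_span_finset_le_card (R := ℝ) ({x, y} : Finset V)
    rw [Finset.coe_pair, Set.finrank, h, finrank_top] at h1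
    have h2 := Finset.card_le_two (a := x) (b := y)
    omega
  obtain ⟨z₀, hz₀⟩ : ∃ z₀, z₀ ∉ Submodule.span ℝ {x, y} := by
    by_contra! h
    exact hspan (Submodule.eq_top_iff'.2 h)
  obtain ⟨z, hz, hxz, hyz⟩ : ∃ z, z ∉ Submodule.span ℝ {x, y} ∧ C x z = 0 ∧ C y z = 0 := by
    refine ⟨z₀ - ((C y z₀ / C x y) • x + (C x z₀ / C x y) • y), fun h => hz₀ ?_, ?_, ?_⟩
    · have h2 : (C y z₀ / C x y) • x + (C x z₀ / C x y) • y ∈ Submodule.span ℝ {x, y} :=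
        Submodule.mem_span_pair.2 ⟨_, _, rfl⟩
      simpa using add_mem h h2
    · simp [hx, hc]
    · simp [hy, hC y x, hc]
  have hzx : C z x = 0 := hC x z ▸ hxz
  have hzy : C z y = 0 := hC y z ▸ hyz
  have hli : ∀ α β γ : ℝ, α • x + β • y + γ • z = 0 → α = 0 ∧ β = 0 ∧ γ = 0 := by
    intro α β γ h
    have hγ : γ = 0 := by
      by_contra hγ
      refine hz (Submodule.mem_span_pair.2 ⟨-(γ⁻¹ * α), -(γ⁻¹ * β), ?_⟩)
      have : γ⁻¹ • (α • x + β • y + γ • z) = 0 := by rw [h, smul_zero]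
      rw [smul_add, smul_add, smul_smul, smul_smul, smul_smul, inv_mul_cancel₀ hγ, one_smul] at this
      rw [neg_smul, neg_smul, ← neg_add, neg_eq_iff_add_eq_zero, this]
    subst hγ
    rw [zero_smul, add_zero] at h
    have := LinearIndependent.pair_iff.1 hxy _ _ h
    exact ⟨this.1, this.2, rfl⟩
  by_cases hd : C z z = 0
  · rcases le_total 0 (L z z) with hLz | hLz
    · refine exists_ne_zero_common_zero_of_isotropic_plane C L
        (LinearIndependent.pair_iff.2 fun α γ h => ?_) hx hd hxz hzx hLx hLz
      have := hli α 0 γ (by simpa using h)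
      exact ⟨this.1, this.2.2⟩
    · refine exists_ne_zero_common_zero_of_isotropic_plane C L
        (LinearIndependent.pair_iff.2 fun γ β h => ?_) hd hy hzy hyz hLz hLy
      have := hli 0 β γ (by simpa [add_comm] using h)
      exact ⟨this.2.2, this.2.1⟩
  -- A conic through `x` and `± y` inside the zero set of `C`.
  obtain ⟨ε, k, hε, hk⟩ : ∃ ε k : ℝ, ε ^ 2 = 1 ∧ 2 * ε * C x y + k ^ 2 * C z z = 0 := by
    rcases le_total 0 (-(2 * C x y) / C z z) with h | h
    · refine ⟨1, √(-(2 * C x y) / C z z), by norm_num, ?_⟩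
      rw [Real.sq_sqrt h]
      field_simp
      ring
    · have h' : 0 ≤ 2 * C x y / C z z := by rw [neg_div] at h; linarith
      refine ⟨-1, √(2 * C x y / C z z), by norm_num, ?_⟩
      rw [Real.sq_sqrt h']
      field_simp
      ring
  let w : ℝ → V := fun t => (1 - t) ^ 2 • x + (ε * t ^ 2) • y + (k * t * (1 - t)) • z
  have hcont : Continuous fun t : ℝ => L (w t) (w t) := by
    simp only [w, map_add, map_smul, LinearMap.add_apply, LinearMap.smul_apply, smul_eq_mul]
    fun_prop
  obtain ⟨t, ht⟩ := mem_range_of_exists_le_of_exists_ge hcont (c := 0)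
    ⟨0, by simpa [w] using hLx⟩ ⟨1, by
      have : L (ε • y) (ε • y) = ε ^ 2 * L y y := by
        simp only [map_smul, LinearMap.smul_apply, smul_eq_mul]; ring
      have hw1 : w 1 = ε • y := by simp [w]
      rw [hw1, this, hε, one_mul]
      exact hLy⟩
  refine ⟨w t, fun h => ?_, ?_, ht⟩
  · obtain ⟨h1, h2, -⟩ := hli _ _ _ h
    have hε0 : ε ≠ 0 := by rintro rfl; norm_num at hε
    have h3 : t = 0 := by simpa [hε0] using h2
    simp [h3] at h1
  · simp only [w, map_add, map_smul, LinearMap.add_apply, LinearMap.smul_apply, smul_eq_mul,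
      hx, hy, hxz, hyz, hzx, hzy, hC y x]
    linear_combination (t ^ 2 * (1 - t) ^ 2) * hk

/-- Polyak's convexity theorem: the joint range of three quadratic forms with a positive definite
combination, on a space of dimension at least three, is closed under addition. -/
theorem exists_quadratic_map_eq_add (Q : Fin 3 → LinearMap.BilinForm ℝ V)
    (hQ : ∀ j u v, Q j u v = Q j v u) (hV : 3 ≤ Module.finrank ℝ V) (s : Fin 3 → ℝ)
    (hs : ∀ x ≠ 0, 0 < ∑ j, s j * Q j x x) (x y : V) :
    ∃ z, ∀ j, Q j z z = Q j x x + Q j y y := by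
  by_cases hx : x = 0
  · exact ⟨y, by simp [hx]⟩
  by_cases hy : y = 0
  · exact ⟨x, by simp [hy]⟩
  let F : V → Fin 3 → ℝ := fun v j => Q j v v
  let σ : (Fin 3 → ℝ) → ℝ := fun a => ∑ j, s j * a j
  obtain ⟨w, hw, hcross⟩ : ∃ w ≠ 0, crossProduct (F w) (F x + F y) = 0 := by
    by_cases hN : crossProduct (F x) (F y) = 0
    · exact ⟨x, hx, by rw [map_add, cross_self, hN, add_zero]⟩
    set N := crossProduct (F x) (F y) with hNdef
    set M := crossProduct (F x + F y) N with hMdef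
    let form : (Fin 3 → ℝ) → LinearMap.BilinForm ℝ V := fun a => ∑ j, a j • Q j
    have form_apply : ∀ a v, form a v v = a ⬝ᵥ F v := by
      intro a v
      simp [form, F, dotProduct, LinearMap.sum_apply]
    have form_symm : ∀ a u v, form a u v = form a v u := by
      intro a u v
      simp [form, LinearMap.sum_apply, hQ _ u v]
    have hli : LinearIndependent ℝ ![x, y] := by
      rw [LinearIndependent.pair_iff' hx]
      rintro c rfl
      apply hN
      have : F (c • x) = (c * c) • F x := by
        ext j; simp [F, mul_assoc]
      rw [hNdef, this, map_smul, cross_self, smul_zero]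
    have hNx : form N x x = 0 := by
      rw [form_apply, dotProduct_comm, hNdef, dot_self_cross]
    have hNy : form N y y = 0 := by
      rw [form_apply, dotProduct_comm, hNdef, dot_cross_self]
    have hM : form M x x + form M y y = 0 := by
      rw [form_apply, form_apply, ← dotProduct_add, dotProduct_comm, hMdef, dot_self_cross]
    obtain ⟨w, hw, hw1, hw2⟩ : ∃ w ≠ 0, form N w w = 0 ∧ form M w w = 0 := by
      rcases le_total (form M x x) 0 with h | h
      · exact exists_ne_zero_common_zero _ _ (form_symm N) hV hli hNx hNy h (by linarith)
      · exact exists_ne_zero_common_zero _ _ (form_symm N) hV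
          (LinearIndependent.pair_symm_iff.1 hli) hNy hNx (by linarith) h
    refine ⟨w, hw, ?_⟩
    rw [form_apply] at hw1 hw2 hNx hNy
    have hNN : N ⬝ᵥ N ≠ 0 := by rwa [Ne, dotProduct_self_eq_zero]
    have key : (N ⬝ᵥ N) • crossProduct (F w) (F x + F y) = 0 := by
      have h1 : crossProduct N M = (N ⬝ᵥ N) • (F x + F y) := by
        have h0 : N ⬝ᵥ (F x + F y) = 0 := by rw [dotProduct_add, hNx, hNy, add_zero]
        generalize F x + F y = e at h0 hMdef ⊢
        rw [hMdef]
        simp only [dotProduct, Fin.sum_univ_three] at h0 ⊢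
        ext j
        fin_cases j <;> simp [cross_apply]
        · linear_combination (-N 0) * h0
        · linear_combination (-N 1) * h0
        · linear_combination (-N 2) * h0
      rw [← map_smul, ← h1]
      simp only [dotProduct, Fin.sum_univ_three] at hw1 hw2
      ext j
      fin_cases j <;> simp [cross_apply]
      · linear_combination N 0 * hw2 - M 0 * hw1
      · linear_combination N 1 * hw2 - M 1 * hw1
      · linear_combination N 2 * hw2 - M 2 * hw1
    exact (smul_eq_zero.1 key).resolve_left hNN
  have hσw : 0 < σ (F w) := hs w hw
  have hσ : 0 < σ (F x + F y) := by
    have : σ (F x + F y) = σ (F x) + σ (F y) := by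
      simp [σ, mul_add, Finset.sum_add_distrib]
    rw [this]
    exact add_pos (hs x hx) (hs y hy)
  have hprop : ∀ j, σ (F x + F y) * F w j = σ (F w) * (F x + F y) j := by
    generalize F x + F y = e at hcross ⊢
    generalize F w = v at hcross ⊢
    have h0 := congrFun hcross 0
    have h1 := congrFun hcross 1
    have h2 := congrFun hcross 2
    simp [cross_apply] at h0 h1 h2
    intro j
    simp only [σ, Fin.sum_univ_three]
    fin_cases j <;> simp
    · linear_combination s 1 * h2 - s 2 * h1
    · linear_combination s 2 * h0 - s 0 * h2
    · linear_combination s 0 * h1 - s 1 * h0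
  refine ⟨√(σ (F x + F y) / σ (F w)) • w, fun j => ?_⟩
  have hr := Real.mul_self_sqrt (div_pos hσ hσw).le
  simp only [map_smul, LinearMap.smul_apply, smul_eq_mul]
  rw [← mul_assoc, hr, div_mul_eq_mul_div, div_eq_iff hσw.ne']
  have := hprop j
  simp only [F, Pi.add_apply] at this ⊢
  linarith

end CommonZeros

/-- Farkas' lemma for convexlike systems satisfying Slater's condition. -/
theorem exists_multipliers_of_convexlike {X ι : Type*} [Fintype ι] (f : X → ℝ) (g : ι → X → ℝ)
    (hconv : ∀ x y : X, ∀ a b : ℝ, 0 ≤ a → 0 ≤ b → a + b = 1 →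
      ∃ z, f z ≤ a * f x + b * f y ∧ ∀ i, g i z ≤ a * g i x + b * g i y)
    (hslater : ∃ x, ∀ i, g i x < 0) (h : ∀ x, (∀ i, g i x ≤ 0) → 0 ≤ f x) :
    ∃ t : ι → ℝ, (∀ i, 0 ≤ t i) ∧ ∀ x, 0 ≤ f x + ∑ i, t i * g i x := by
  classical
  let S : Set (ℝ × (ι → ℝ)) := {u | ∃ x, f x < u.1 ∧ ∀ i, g i x < u.2 i}
  have hSopen : IsOpen S := by
    have : S = ⋃ x, {u | f x < u.1 ∧ ∀ i, g i x < u.2 i} := by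
      ext u; simp [S]
    rw [this]
    refine isOpen_iUnion fun x => ?_
    refine (isOpen_lt continuous_const continuous_fst).inter ?_
    change IsOpen {u : ℝ × (ι → ℝ) | ∀ i, g i x < u.2 i}
    rw [Set.ofPred_forall]
    exact isOpen_iInter_of_finite fun i => isOpen_lt continuous_const (by fun_prop)
  have hSconv : Convex ℝ S := by
    rintro u ⟨x, hx, hx'⟩ v ⟨y, hy, hy'⟩ a b ha hb hab
    obtain ⟨z, hz, hz'⟩ := hconv x y a b ha hb hab
    have comb : ∀ {p q p' q' : ℝ}, p < p' → q < q' → a * p + b * q < a * p' + b * q' := by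
      intro p q p' q' hp hq
      rcases ha.eq_or_lt with rfl | ha'
      · have : b = 1 := by linarith
        subst this
        linarith
      · have h1 := mul_lt_mul_of_pos_left hp ha'
        have h2 := mul_le_mul_of_nonneg_left hq.le hb
        linarith
    exact ⟨z, hz.trans_lt (by simpa using comb hx hy),
      fun i => (hz' i).trans_lt (by simpa using comb (hx' i) (hy' i))⟩
  have hS0 : (0 : ℝ × (ι → ℝ)) ∉ S := by
    rintro ⟨x, hx, hx'⟩
    exact absurd (h x fun i => (hx' i).le) (not_le.2 hx)
  obtain ⟨φ, hφ⟩ := geometric_hahn_banach_open_point hSconv hSopen hS0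
  obtain ⟨c, d, hcd⟩ : ∃ (c : ℝ) (d : ι → ℝ), ∀ u, φ u = -(c * u.1 + ∑ i, d i * u.2 i) := by
    refine ⟨-φ (1, 0), fun i => -φ (0, Pi.single i 1), fun u => ?_⟩
    have hu : u = u.1 • ((1 : ℝ), (0 : ι → ℝ)) +
        ∑ i, u.2 i • ((0 : ℝ), (Pi.single i 1 : ι → ℝ)) := by
      ext j
      · simp [Prod.fst_sum]
      · simp [Prod.snd_sum, Finset.sum_apply, Pi.single_apply]
    conv_lhs => rw [hu]
    simp only [map_add, map_smul, map_sum, smul_eq_mul, neg_mul, Finset.sum_neg_distrib]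
    rw [neg_add, neg_neg, neg_neg, mul_comm]
    simp [mul_comm]
  have hpos : ∀ x (δ : ℝ) (η : ι → ℝ), 0 < δ → (∀ i, 0 < η i) →
      0 < c * (f x + δ) + ∑ i, d i * (g i x + η i) := by
    intro x δ η hδ hη
    have := hφ (f x + δ, fun i => g i x + η i) ⟨x, by simpa using hδ, fun i => by simpa using hη i⟩
    rw [map_zero, hcd] at this
    exact neg_lt_zero.1 this
  have hlin : ∀ K e : ℝ, (∀ r, 0 < r → 0 < K + e * r) → 0 ≤ e := by
    intro K e hK
    by_contra! he
    have h1 := hK ((|K| + 1) / -e) (by have := abs_nonneg K; apply div_pos <;> linarith)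
    have h2 : e * ((|K| + 1) / -e) = -(|K| + 1) := by
      rw [div_neg, mul_neg, mul_div_cancel₀ _ he.ne]
    rw [h2] at h1
    linarith [le_abs_self K]
  obtain ⟨x₀, hx₀⟩ := hslater
  have hc : 0 ≤ c := by
    refine hlin (c * f x₀ + ∑ i, d i * (g i x₀ + 1)) c fun r hr => ?_
    have := hpos x₀ r (fun _ => 1) hr fun _ => one_pos
    linarith
  have hd : ∀ j, 0 ≤ d j := by
    intro j
    refine hlin (c * (f x₀ + 1) + ∑ i, d i * (g i x₀ + 1)) (d j) fun r hr => ?_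
    have := hpos x₀ 1 (fun i => 1 + if i = j then r else 0) one_pos
      fun i => by split_ifs <;> linarith
    simp only [← add_assoc, mul_add _ (_ + _) (ite _ _ _), Finset.sum_add_distrib, mul_ite,
      mul_zero, Finset.sum_ite_eq', Finset.mem_univ, if_true] at this
    simp only [mul_add, Finset.sum_add_distrib] at this ⊢
    linarith
  have hnonneg : ∀ x, 0 ≤ c * f x + ∑ i, d i * g i x := by
    intro x
    refine le_of_forall_pos_le_add fun ε hε => ?_
    have hE : 0 < c + ∑ i, d i + 1 := by
      have := Finset.sum_nonneg fun i (_ : i ∈ Finset.univ) => hd i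
      linarith
    have := hpos x (ε / (c + ∑ i, d i + 1)) (fun _ => ε / (c + ∑ i, d i + 1))
      (div_pos hε hE) fun _ => div_pos hε hE
    simp only [mul_add, Finset.sum_add_distrib, ← Finset.sum_mul] at this
    have h3 : (c + ∑ i, d i + 1) * (ε / (c + ∑ i, d i + 1)) = ε := by field_simp
    have h4 := div_pos hε hE
    linarith
  have hc' : 0 < c := by
    refine hc.lt_of_ne' fun hc0 => ?_
    have h1 := hnonneg x₀
    rw [hc0, zero_mul, zero_add] at h1
    have h2 : ∀ i ∈ Finset.univ, d i * g i x₀ ≤ 0 := fun i _ =>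
      mul_nonpos_of_nonneg_of_nonpos (hd i) (hx₀ i).le
    have h3 := (Finset.sum_eq_zero_iff_of_nonpos h2).1 (le_antisymm (Finset.sum_nonpos h2) h1)
    have h4 : ∀ i, d i = 0 := fun i =>
      (mul_eq_zero.1 (h3 i (Finset.mem_univ i))).resolve_right (hx₀ i).ne
    have := hpos x₀ 1 (fun _ => 1) one_pos fun _ => one_pos
    simp [hc0, h4] at this
  refine ⟨fun i => d i / c, fun i => div_nonneg (hd i) hc, fun x => ?_⟩
  have h1 : f x + ∑ i, d i / c * g i x = (c * f x + ∑ i, d i * g i x) / c := by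
    rw [add_div, Finset.sum_div, mul_div_cancel_left₀ _ hc'.ne']
    simp only [div_mul_eq_mul_div]
  rw [h1]
  exact div_nonneg (hnonneg x) hc

theorem further_extended_s_lemma (n m : ℕ) (hn : 3 ≤ n) (hm : 1 ≤ m)
    (B₀ : Matrix (Fin n) (Fin n) ℝ) (B : Fin m → Matrix (Fin n) (Fin n) ℝ)
    (A : Fin 3 → Matrix (Fin n) (Fin n) ℝ)
    (hB₀sym : B₀.IsSymm) (hBsym : ∀ i, (B i).IsSymm) (hAsym : ∀ j, (A j).IsSymm)
    (hgen₀ : ∃ r : Fin 3 → ℝ, B₀ = ∑ j, r j • A j)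
    (hgen : ∀ i, ∃ r : Fin 3 → ℝ, B i = ∑ j, r j • A j)
    (hs : ∃ s : Fin 3 → ℝ, (∑ j, s j • A j).PosDef)
    (β₀ : ℝ) (β : Fin m → ℝ)
    (hslater : ∃ xbar : Fin n → ℝ, ∀ i, xbar ⬝ᵥ (B i) *ᵥ xbar < β i) :
    (∀ x : Fin n → ℝ, (∀ i, x ⬝ᵥ (B i) *ᵥ x ≤ β i) → β₀ ≤ x ⬝ᵥ B₀ *ᵥ x) ↔
    (∃ t : Fin m → ℝ, (∀ i, 0 ≤ t i) ∧ (B₀ + ∑ i, t i • B i).PosSemidef ∧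
      β₀ + ∑ i, t i * β i ≤ 0) := by
  have hsum : ∀ {k : ℕ} (r : Fin k → ℝ) (M : Fin k → Matrix (Fin n) (Fin n) ℝ) (x : Fin n → ℝ),
      x ⬝ᵥ (∑ j, r j • M j) *ᵥ x = ∑ j, r j * (x ⬝ᵥ M j *ᵥ x) := by
    intro k r M x
    simp [Matrix.sum_mulVec, dotProduct_sum, smul_mulVec]
  have hlag : ∀ (t : Fin m → ℝ) (x : Fin n → ℝ),
      x ⬝ᵥ (B₀ + ∑ i, t i • B i) *ᵥ x = x ⬝ᵥ B₀ *ᵥ x + ∑ i, t i * (x ⬝ᵥ B i *ᵥ x) := by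
    intro t x
    rw [add_mulVec, dotProduct_add, hsum]
  constructor
  · intro h
    obtain ⟨s, hs⟩ := hs
    obtain ⟨r₀, hr₀⟩ := hgen₀
    choose r hr using hgen
    have hadd : ∀ x y : Fin n → ℝ, ∃ z : Fin n → ℝ,
        ∀ j, z ⬝ᵥ A j *ᵥ z = x ⬝ᵥ A j *ᵥ x + y ⬝ᵥ A j *ᵥ y := by
      intro x y
      have := exists_quadratic_map_eq_add (fun j => Matrix.toBilin' (A j)) (fun j u v => ?_)
        (by simpa using hn) s (fun x hx => ?_) x y
      · simpa only [Matrix.toBilin'_apply'] using this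
      · simp only [Matrix.toBilin'_apply']
        rw [dotProduct_mulVec, ← mulVec_transpose, (hAsym j).eq, dotProduct_comm]
      · simp only [Matrix.toBilin'_apply']
        rw [← hsum]
        simpa using hs.dotProduct_mulVec_pos hx
    have hconv : ∀ (x y : Fin n → ℝ) (a b : ℝ), 0 ≤ a → 0 ≤ b → ∃ z : Fin n → ℝ,
        ∀ j, z ⬝ᵥ A j *ᵥ z = a * (x ⬝ᵥ A j *ᵥ x) + b * (y ⬝ᵥ A j *ᵥ y) := by
      intro x y a b ha hb
      obtain ⟨z, hz⟩ := hadd (√a • x) (√b • y)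
      refine ⟨z, fun j => ?_⟩
      rw [hz]
      simp only [mulVec_smul, smul_dotProduct, dotProduct_smul, smul_eq_mul, ← mul_assoc,
        Real.mul_self_sqrt ha, Real.mul_self_sqrt hb]
    have hcomb : ∀ (r : Fin 3 → ℝ) (x y z : Fin n → ℝ) (a b : ℝ),
        (∀ j, z ⬝ᵥ A j *ᵥ z = a * (x ⬝ᵥ A j *ᵥ x) + b * (y ⬝ᵥ A j *ᵥ y)) →
        z ⬝ᵥ (∑ j, r j • A j) *ᵥ z =
          a * (x ⬝ᵥ (∑ j, r j • A j) *ᵥ x) + b * (y ⬝ᵥ (∑ j, r j • A j) *ᵥ y) := by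
      intro r x y z a b hz
      rw [hsum, hsum, hsum, Finset.mul_sum, Finset.mul_sum, ← Finset.sum_add_distrib]
      refine Finset.sum_congr rfl fun j _ => ?_
      rw [hz]
      ring
    obtain ⟨t, ht, hL⟩ := exists_multipliers_of_convexlike
      (fun x : Fin n → ℝ => x ⬝ᵥ B₀ *ᵥ x - β₀) (fun i x => x ⬝ᵥ B i *ᵥ x - β i)
      (fun x y a b ha hb hab => by
        obtain ⟨z, hz⟩ := hconv x y a b ha hb
        refine ⟨z, le_of_eq ?_, fun i => le_of_eq ?_⟩
        · simp only [hr₀, hcomb r₀ x y z a b hz]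
          linear_combination β₀ * hab
        · simp only [hr i, hcomb (r i) x y z a b hz]
          linear_combination β i * hab)
      (hslater.imp fun x hx i => sub_neg.2 (hx i))
      (fun x hx => sub_nonneg.2 (h x fun i => sub_nonpos.1 (hx i)))
    have hL' : ∀ x : Fin n → ℝ,
        β₀ + ∑ i, t i * β i ≤ x ⬝ᵥ (B₀ + ∑ i, t i • B i) *ᵥ x := by
      intro x
      have := hL x
      simp only [mul_sub, Finset.sum_sub_distrib] at this
      rw [hlag]
      linarith
    refine ⟨t, ht, ?_, by simpa using hL' 0⟩
    refine PosSemidef.of_dotProduct_mulVec_nonneg ?_ fun x => ?_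
    · change (B₀ + ∑ i, t i • B i)ᴴ = _
      simp [conjTranspose_eq_transpose_of_trivial, transpose_sum, hB₀sym.eq, (hBsym _).eq]
    · rw [star_trivial]
      by_contra! hneg
      set q := x ⬝ᵥ (B₀ + ∑ i, t i • B i) *ᵥ x with hq
      set K := β₀ + ∑ i, t i * β i with hK
      have hscale : ((|K| + 1) / -q) * q < K := by
        have : ((|K| + 1) / -q) * q = -(|K| + 1) := by
          rw [div_neg, neg_mul, div_mul_cancel₀ _ hneg.ne]
        rw [this]
        linarith [neg_abs_le K]
      have hrad : 0 ≤ (|K| + 1) / -q :=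
        div_nonneg (by positivity) (by linarith)
      have := hL' (√((|K| + 1) / -q) • x)
      rw [mulVec_smul, smul_dotProduct, dotProduct_smul, smul_eq_mul, smul_eq_mul, ← mul_assoc,
        Real.mul_self_sqrt hrad] at this
      linarith
  · rintro ⟨t, ht, hpsd, hle⟩ x hx
    have h1 : 0 ≤ x ⬝ᵥ (B₀ + ∑ i, t i • B i) *ᵥ x := by
      simpa using hpsd.dotProduct_mulVec_nonneg x
    rw [hlag] at h1
    have h2 : ∑ i, t i * (x ⬝ᵥ B i *ᵥ x) ≤ ∑ i, t i * β i :=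
      Finset.sum_le_sum fun i _ => mul_le_mul_of_nonneg_left (hx i) (ht i)
    linarith
end

section
/- Let n ≥ 3, m ≥ 1, and let B₀, B₁, …, Bₘ be real symmetric n×n matrices, each a real linear combination of A₁, A₂, A₃ with s₁A₁ + s₂A₂ + s₃A₃ positive definite. Let β₀, …, βₘ ∈ ℝ and assume there exist x̄, x̄' ∈ ℝⁿ with x̄ᵀBᵢx̄ < βᵢ for i = 1,…,m, and x̄'ᵀB₁x̄' > β₁ while x̄'ᵀBᵢx̄' < βᵢ for i = 2,…,m. Then the implication (xᵀB₁x = β₁ and xᵀBᵢx ≤ βᵢ for i = 2,…,m ⟹ xᵀB₀x ≥ β₀) holds if and only if there exist t₁ ∈ ℝ and t₂, …, tₘ ≥ 0 with B₀ + Σᵢ tᵢBᵢ positive semidefinite and β₀ + Σᵢ tᵢβᵢ ≤ 0. -/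
open Matrix

section IsotropicPaths

variable {E : Type*} [AddCommGroup E] [Module ℝ E]

/-- The nonzero isotropic vectors of a bilinear form. -/
def isotropicSet (B : LinearMap.BilinForm ℝ E) : Set E := {z | B z z = 0 ∧ z ≠ 0}

theorem neg_mem_isotropicSet {B : LinearMap.BilinForm ℝ E} {x : E} (hx : x ∈ isotropicSet B) :
    -x ∈ isotropicSet B :=
  ⟨by simpa using hx.1, neg_ne_zero.2 hx.2⟩

theorem exists_ne_zero_orthogonal_pair (B : LinearMap.BilinForm ℝ E)
    (hE : 2 < Module.finrank ℝ E) (x y : E) : ∃ w ≠ 0, B x w = 0 ∧ B y w = 0 := by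
  have : FiniteDimensional ℝ E := Module.finite_of_finrank_pos (by omega)
  have hker : ((B x).prod (B y)).ker ≠ ⊥ := LinearMap.ker_ne_bot_of_finrank_lt (by simpa using hE)
  obtain ⟨w, hw, hw0⟩ := Submodule.exists_mem_ne_zero_of_ne_bot hker
  refine ⟨w, hw0, ?_⟩
  simpa using hw

variable [TopologicalSpace E] [IsTopologicalAddGroup E] [ContinuousSMul ℝ E]

theorem joinedIn_isotropicSet_of_orthogonal {B : LinearMap.BilinForm ℝ E} (hB : B.IsSymm) {x y : E}
    (hx : x ∈ isotropicSet B) (hy : y ∈ isotropicSet B) (hxy : B x y = 0) :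
    JoinedIn (isotropicSet B) x y ∨ JoinedIn (isotropicSet B) x (-y) := by
  obtain ⟨hxx, hx0⟩ := hx
  obtain ⟨hyy, hy0⟩ := hy
  have hyx : B y x = 0 := by rw [hB.eq, hxy]
  by_cases h : (0 : E) ∈ segment ℝ x y
  · right
    apply JoinedIn.of_segment_subset
    rintro _ ⟨a, b, ha, hb, hab, rfl⟩
    refine ⟨by simp [hxx, hyy, hxy, hyx], fun h0 => ?_⟩
    obtain ⟨c, d, hc, hd, hcd, h1⟩ := h
    have hsmul : (a * d + b * c) • x = 0 := by
      linear_combination (norm := module) d • h0 + b • h1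
    have h2 : a * d + b * c = 0 := (smul_eq_zero.1 hsmul).resolve_right hx0
    have h3 : a * d = 0 := by nlinarith [mul_nonneg ha hd, mul_nonneg hb hc]
    have h4 : b * c = 0 := by linarith
    rcases mul_eq_zero.1 h3 with rfl | rfl
    · obtain rfl : b = 1 := by linarith
      simp [hy0] at h0
    · obtain rfl : c = 1 := by linarith
      simp [hx0] at h1
  · left
    apply JoinedIn.of_segment_subset
    intro z hz
    refine ⟨?_, fun h0 => h (h0 ▸ hz)⟩
    obtain ⟨a, b, -, -, -, rfl⟩ := hz
    simp [hxx, hyy, hxy, hyx]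

theorem joinedIn_isotropicSet_of_conic {B : LinearMap.BilinForm ℝ E} (hB : B.IsSymm) {x y w : E}
    (hx : x ∈ isotropicSet B) (hy : y ∈ isotropicSet B) (hxw : B x w = 0) (hyw : B y w = 0)
    (hxy : B x y ≠ 0) (hw : B w w = -2 * B x y) :
    JoinedIn (isotropicSet B) x y := by
  have hwx : B w x = 0 := by rw [hB.eq, hxw]
  have hwy : B w y = 0 := by rw [hB.eq, hyw]
  have hyx := hB.eq y x
  refine JoinedIn.ofLine (f := fun t => (1 - t) ^ 2 • x + t ^ 2 • y + (t * (1 - t)) • w)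
    (by fun_prop) (by simp) (by simp) ?_
  rintro _ ⟨t, -, rfl⟩
  refine ⟨?_, fun h0 => ?_⟩
  · simp only [map_add, map_smul, LinearMap.add_apply, LinearMap.smul_apply, smul_eq_mul,
      hx.1, hy.1, hxw, hyw, hwx, hwy, hw, hyx]
    ring
  · have h1 := congrArg (B x) h0
    have h2 := congrArg (B y) h0
    simp [hx.1, hxw, hxy] at h1
    simp [hy.1, hyw, hyx, hxy] at h2
    subst h1
    norm_num at h2

/-- In dimension at least three, two nonzero isotropic vectors are joined by a path of nonzero
isotropic vectors, up to a sign. -/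
theorem joinedIn_isotropicSet {B : LinearMap.BilinForm ℝ E} (hB : B.IsSymm)
    (hE : 2 < Module.finrank ℝ E) {x y : E}
    (hx : x ∈ isotropicSet B) (hy : y ∈ isotropicSet B) :
    JoinedIn (isotropicSet B) x y ∨ JoinedIn (isotropicSet B) x (-y) := by
  by_cases hxy : B x y = 0
  · exact joinedIn_isotropicSet_of_orthogonal hB hx hy hxy
  obtain ⟨w, hw0, hxw, hyw⟩ := exists_ne_zero_orthogonal_pair B hE x y
  have hwy : B w y = 0 := by rw [hB.eq, hyw]
  by_cases hww : B w w = 0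
  · have key : ∀ v ∈ isotropicSet B, B v y = 0 → JoinedIn (isotropicSet B) x v →
        JoinedIn (isotropicSet B) x y ∨ JoinedIn (isotropicSet B) x (-y) := fun v hv hvy hj =>
      (joinedIn_isotropicSet_of_orthogonal hB hv hy hvy).imp hj.trans hj.trans
    rcases joinedIn_isotropicSet_of_orthogonal hB hx ⟨hww, hw0⟩ hxw with h | h
    · exact key w ⟨hww, hw0⟩ hwy h
    · exact key (-w) (neg_mem_isotropicSet ⟨hww, hw0⟩) (by simp [hwy]) h
  · have key : ∀ v ∈ isotropicSet B, B v w = 0 → 0 < -2 * B x v / B w w →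
        JoinedIn (isotropicSet B) x v := by
      intro v hv hvw hpos
      refine joinedIn_isotropicSet_of_conic (w := √(-2 * B x v / B w w) • w) hB hx hv
        (by simp [hxw]) (by simp [hvw]) (fun h => by simp [h] at hpos) ?_
      simp only [map_smul, LinearMap.smul_apply, smul_eq_mul, ← mul_assoc,
        Real.mul_self_sqrt hpos.le]
      field_simp
    have hne : -2 * B x y / B w w ≠ 0 := by simp [hxy, hww]
    rcases hne.lt_or_gt with h | h
    · right
      refine key (-y) (neg_mem_isotropicSet hy) (by simp [hyw]) ?_
      have : -2 * B x (-y) / B w w = -(-2 * B x y / B w w) := by simp [neg_div]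
      linarith
    · exact Or.inl (key y hy hyw h)

end IsotropicPaths

theorem crossProduct_eq_zero_of_coplanar {l r w : Fin 3 → ℝ} (hl : l ≠ 0) (hr : r ⬝ᵥ l = 0)
    (hw : w ⬝ᵥ l = 0) (hrw : r ⬝ᵥ crossProduct w l = 0) : crossProduct r w = 0 := by
  have hpos : l ⬝ᵥ l ≠ 0 := by simpa using hl
  have h : (l ⬝ᵥ l) • crossProduct r w = 0 := by
    simp only [dotProduct, Fin.sum_univ_three, cross_apply, cons_val_zero, cons_val_one,
      cons_val] at hr hw hrw ⊢
    ext i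
    fin_cases i <;> simp [-mul_eq_zero]
    · linear_combination l 0 * hrw - (l 1 * r 2 - l 2 * r 1) * hw + (l 1 * w 2 - l 2 * w 1) * hr
    · linear_combination l 1 * hrw - (l 2 * r 0 - l 0 * r 2) * hw + (l 2 * w 0 - l 0 * w 2) * hr
    · linear_combination l 2 * hrw - (l 0 * r 1 - l 1 * r 0) * hw + (l 0 * w 1 - l 1 * w 0) * hr
  exact (smul_eq_zero.1 h).resolve_left hpos

theorem eq_smul_of_crossProduct_eq_zero {r w s : Fin 3 → ℝ} (h : crossProduct r w = 0)
    (hs : s ⬝ᵥ r ≠ 0) : w = (s ⬝ᵥ w / s ⬝ᵥ r) • r := by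
  have h' : (s ⬝ᵥ w) • r = (s ⬝ᵥ r) • w := by
    have := cross_cross_eq_smul_sub_smul' s r w
    rwa [h, map_zero, eq_comm, sub_eq_zero, dotProduct_comm r s] at this
  rw [div_eq_inv_mul, mul_smul, h', inv_smul_smul₀ hs]

theorem dotProduct_crossProduct_left (p q : Fin 3 → ℝ) (a b : ℝ) :
    p ⬝ᵥ crossProduct (a • p + b • q) (crossProduct p q) =
      b * (crossProduct p q ⬝ᵥ crossProduct p q) := by
  simp only [vec3_dotProduct, cross_apply, Pi.add_apply, Pi.smul_apply, smul_eq_mul, cons_val_zero,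
    cons_val_one, cons_val]
  ring

theorem dotProduct_crossProduct_right (p q : Fin 3 → ℝ) (a b : ℝ) :
    q ⬝ᵥ crossProduct (a • p + b • q) (crossProduct p q) =
      -(a * (crossProduct p q ⬝ᵥ crossProduct p q)) := by
  simp only [vec3_dotProduct, cross_apply, Pi.add_apply, Pi.smul_apply, smul_eq_mul, cons_val_zero,
    cons_val_one, cons_val]
  ring

section JointForm

variable {n : Type*} [Fintype n]

/-- The values at `x` of the three quadratic forms given by the matrices `A j`. -/
def jointForm (A : Fin 3 → Matrix n n ℝ) (x : n → ℝ) : Fin 3 → ℝ := fun j => x ⬝ᵥ A j *ᵥ x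

theorem dotProduct_jointForm (A : Fin 3 → Matrix n n ℝ) (r : Fin 3 → ℝ) (x : n → ℝ) :
    r ⬝ᵥ jointForm A x = x ⬝ᵥ (∑ j, r j • A j) *ᵥ x := by
  simp only [sum_mulVec, smul_mulVec, dotProduct_sum, dotProduct_smul, smul_eq_mul]
  rfl

theorem jointForm_smul (A : Fin 3 → Matrix n n ℝ) (c : ℝ) (x : n → ℝ) :
    jointForm A (c • x) = c ^ 2 • jointForm A x := by
  ext j
  simp [jointForm, mulVec_smul, pow_two, mul_assoc]

theorem jointForm_neg (A : Fin 3 → Matrix n n ℝ) (x : n → ℝ) :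
    jointForm A (-x) = jointForm A x := by
  simpa using jointForm_smul A (-1) x

theorem continuous_jointForm (A : Fin 3 → Matrix n n ℝ) : Continuous (jointForm A) := by
  unfold jointForm
  fun_prop

theorem exists_jointForm_eq_smul (A : Fin 3 → Matrix n n ℝ) (x : n → ℝ) {c : ℝ} (hc : 0 ≤ c) :
    ∃ z, jointForm A z = c • jointForm A x :=
  ⟨√c • x, by rw [jointForm_smul, Real.sq_sqrt hc]⟩

/-- For three quadratic forms in at least three variables with a positive definite combination,
the joint range is convex. -/
theorem convex_range_jointForm {A : Fin 3 → Matrix n n ℝ} (hn : 2 < Fintype.card n)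
    (hA : ∀ j, (A j).IsSymm) {s : Fin 3 → ℝ} (hs : (∑ j, s j • A j).PosDef) :
    Convex ℝ (Set.range (jointForm A)) := by
  classical
  have hpos : ∀ x ≠ 0, 0 < s ⬝ᵥ jointForm A x := fun x hx => by
    rw [dotProduct_jointForm]
    exact (posDef_iff_dotProduct_mulVec.1 hs).2 hx
  rintro _ ⟨x, rfl⟩ _ ⟨y, rfl⟩ a b ha hb hab
  have zero : jointForm A 0 = 0 := by ext; simp [jointForm]
  rcases eq_or_ne x 0 with rfl | hx
  · rw [zero, smul_zero, zero_add]
    exact exists_jointForm_eq_smul A y hb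
  rcases eq_or_ne y 0 with rfl | hy
  · rw [zero, smul_zero, add_zero]
    exact exists_jointForm_eq_smul A x ha
  set p := jointForm A x with hp
  set q := jointForm A y with hq
  have hw : 0 < s ⬝ᵥ (a • p + b • q) := by
    rw [dotProduct_add, dotProduct_smul, dotProduct_smul, smul_eq_mul, smul_eq_mul]
    rcases ha.eq_or_lt with rfl | ha
    · nlinarith [hpos y hy]
    · nlinarith [mul_pos ha (hpos x hx), mul_nonneg hb (hpos y hy).le]
  have of_parallel : ∀ z ≠ 0, crossProduct (jointForm A z) (a • p + b • q) = 0 →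
      a • p + b • q ∈ Set.range (jointForm A) := fun z hz h => by
    rw [eq_smul_of_crossProduct_eq_zero h (hpos z hz).ne']
    exact exists_jointForm_eq_smul A z (div_pos hw (hpos z hz)).le
  by_cases hl : crossProduct p q = 0
  · exact of_parallel x hx (by simp [← hp, hl, cross_self])
  set l := crossProduct p q with hldef
  set B := Matrix.toBilin' (∑ j, l j • A j) with hBdef
  have hB : B.IsSymm := by
    rw [hBdef, isSymm_toBilin'_iff_isSymm]
    simp [Matrix.IsSymm, transpose_sum, fun j => (hA j).eq]
  have hBz : ∀ z, B z z = jointForm A z ⬝ᵥ l := fun z => by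
    rw [hBdef, toBilin'_apply', dotProduct_comm _ l, dotProduct_jointForm]
  have hxB : x ∈ isotropicSet B := ⟨by rw [hBz, ← hp, hldef, dot_self_cross], hx⟩
  have hyB : y ∈ isotropicSet B := ⟨by rw [hBz, ← hq, hldef, dot_cross_self], hy⟩
  have of_joined : ∀ y', jointForm A y' = q → JoinedIn (isotropicSet B) x y' →
      a • p + b • q ∈ Set.range (jointForm A) := by
    rintro y' hy' ⟨γ, hγ⟩
    have hl0 : 0 ≤ l ⬝ᵥ l := by simpa using dotProduct_star_self_nonneg l
    have hcont : Continuous fun t => jointForm A (γ t) ⬝ᵥ crossProduct (a • p + b • q) l :=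
      ((continuous_jointForm A).comp γ.continuous).dotProduct continuous_const
    obtain ⟨t, ht⟩ := mem_range_of_exists_le_of_exists_ge (c := 0) hcont
      ⟨1, by
        rw [γ.target, hy', hldef, dotProduct_crossProduct_right, neg_nonpos]
        exact mul_nonneg ha hl0⟩
      ⟨0, by
        rw [γ.source, ← hp, hldef, dotProduct_crossProduct_left]
        exact mul_nonneg hb hl0⟩
    refine of_parallel (γ t) (hγ t).2 (crossProduct_eq_zero_of_coplanar hl ?_ ?_ ht)
    · rw [← hBz]
      exact (hγ t).1
    · rw [add_dotProduct, smul_dotProduct, smul_dotProduct, hldef, dot_self_cross, dot_cross_self]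
      simp
  rcases joinedIn_isotropicSet hB (by simpa using hn) hxB hyB with h | h
  · exact of_joined y rfl h
  · exact of_joined (-y) (jointForm_neg A y) h

end JointForm

section Duality

theorem nonneg_of_forall_add_mul_nonneg {S g : ℝ} (h : ∀ r, 0 ≤ r → 0 ≤ S + r * g) : 0 ≤ g := by
  by_contra! hg
  have hS := h 0 le_rfl
  have h1 := h ((S + 1) / -g) (div_nonneg (by linarith) (by linarith))
  rw [div_mul_eq_mul_div, div_neg, mul_div_cancel_right₀ _ hg.ne] at h1
  linarith

theorem apply_eq_mul_add_sum {ι : Type*} [Fintype ι] [DecidableEq ι]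
    (f : (ℝ × (ι → ℝ)) →ₗ[ℝ] ℝ) (u : ℝ × (ι → ℝ)) :
    f u = u.1 * f (1, 0) + ∑ i, u.2 i * f (0, Pi.single i 1) := by
  have h : u = u.1 • (1, 0) + ∑ i, u.2 i • (0, Pi.single i 1) := by
    ext j
    · simp [Prod.fst_sum]
    · simp [Prod.snd_sum, Finset.sum_apply, Pi.single_apply]
  conv_lhs => rw [h]
  simp only [map_add, map_sum, map_smul, smul_eq_mul]

variable {V ι : Type*} [AddCommGroup V] [Module ℝ V]

/-- The pairs `u` that dominate the objective and constraint values of some point of `K`, with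
equality in the constraint `i₀`. -/
def valueSet (K : Set V) (φ₀ : V →ₗ[ℝ] ℝ) (φ : ι → V →ₗ[ℝ] ℝ) (β₀ : ℝ) (β : ι → ℝ) (i₀ : ι) :
    Set (ℝ × (ι → ℝ)) :=
  {u | ∃ z ∈ K, φ₀ z - β₀ ≤ u.1 ∧ φ i₀ z - β i₀ = u.2 i₀ ∧ ∀ i ≠ i₀, φ i z - β i ≤ u.2 i}

variable {K : Set V} {φ₀ : V →ₗ[ℝ] ℝ} {φ : ι → V →ₗ[ℝ] ℝ} {β₀ : ℝ} {β : ι → ℝ} {i₀ : ι}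

theorem combo_sub_eq (ψ : V →ₗ[ℝ] ℝ) (c : ℝ) (z w : V) {a b : ℝ} (hab : a + b = 1) :
    ψ (a • z + b • w) - c = a * (ψ z - c) + b * (ψ w - c) := by
  simp only [map_add, map_smul, smul_eq_mul]
  linear_combination c * hab

theorem convex_valueSet (hK : Convex ℝ K) : Convex ℝ (valueSet K φ₀ φ β₀ β i₀) := by
  rintro u ⟨z, hz, hz0, hz1, hz2⟩ v ⟨w, hw, hw0, hw1, hw2⟩ a b ha hb hab
  refine ⟨a • z + b • w, hK hz hw ha hb hab, ?_, ?_, fun i hi => ?_⟩ <;>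
    rw [combo_sub_eq _ _ _ _ hab]
  · exact add_le_add (mul_le_mul_of_nonneg_left hz0 ha) (mul_le_mul_of_nonneg_left hw0 hb)
  · rw [hz1, hw1]
    rfl
  · exact add_le_add (mul_le_mul_of_nonneg_left (hz2 i hi) ha)
      (mul_le_mul_of_nonneg_left (hw2 i hi) hb)

theorem zero_notMem_interior_valueSet
    (h : ∀ z ∈ K, φ i₀ z = β i₀ → (∀ i ≠ i₀, φ i z ≤ β i) → β₀ ≤ φ₀ z) :
    0 ∉ interior (valueSet K φ₀ φ β₀ β i₀) := by
  intro h0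
  have hcont : Continuous fun e : ℝ => ((e, 0) : ℝ × (ι → ℝ)) := by fun_prop
  have hev : ∀ᶠ e in nhdsWithin (0 : ℝ) (Set.Iio 0), ((e, 0) : ℝ × (ι → ℝ)) ∈
      valueSet K φ₀ φ β₀ β i₀ :=
    nhdsWithin_le_nhds (hcont.continuousAt (mem_interior_iff_mem_nhds.1 h0))
  obtain ⟨e, ⟨z, hz, hz0, hz1, hz2⟩, he⟩ := (hev.and self_mem_nhdsWithin).exists
  have := h z hz (by simpa [sub_eq_zero] using hz1) fun i hi => by simpa using hz2 i hi
  have he' : e < 0 := he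
  have : φ₀ z - β₀ ≤ e := hz0
  linarith

variable [Fintype ι] [DecidableEq ι]

theorem interior_valueSet_nonempty (hK : Convex ℝ K) {z w : V} (hz : z ∈ K) (hw : w ∈ K)
    (hz₀ : φ i₀ z < β i₀) (hw₀ : β i₀ < φ i₀ w) (hzi : ∀ i ≠ i₀, φ i z < β i)
    (hwi : ∀ i ≠ i₀, φ i w < β i) : (interior (valueSet K φ₀ φ β₀ β i₀)).Nonempty := by
  set M := max (φ₀ z - β₀) (φ₀ w - β₀)
  set u₀ : ℝ × (ι → ℝ) := (M + 1, fun i => if i = i₀ then 0 else 1) with hu₀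
  refine ⟨u₀, mem_interior_iff_mem_nhds.2 ?_⟩
  have hsnd : ∀ i, Filter.Tendsto (fun u : ℝ × (ι → ℝ) => u.2 i) (nhds u₀) (nhds (u₀.2 i)) :=
    fun i => Continuous.tendsto (by fun_prop) u₀
  have h1 : ∀ᶠ u in nhds u₀, M < u.1 :=
    (continuous_fst.tendsto u₀).eventually_const_lt (by simp [hu₀])
  have h2 := (hsnd i₀).eventually_const_lt (u := φ i₀ z - β i₀) (by simpa [hu₀] using hz₀)
  have h3 := (hsnd i₀).eventually_lt_const (u := φ i₀ w - β i₀) (by simpa [hu₀] using hw₀)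
  have h4 : ∀ᶠ u in nhds u₀, ∀ i, i ≠ i₀ → 0 < u.2 i := by
    refine Filter.eventually_all.2 fun i => ?_
    by_cases hi : i = i₀
    · simp [hi]
    · simpa [hi] using (hsnd i).eventually_const_lt (u := 0) (by simp [hu₀, hi])
  filter_upwards [h1, h2, h3, h4] with u h1 h2 h3 h4
  set D := φ i₀ w - φ i₀ z with hD
  have hDpos : 0 < D := by linarith
  set a := (φ i₀ w - β i₀ - u.2 i₀) / D with ha_def
  set b := (u.2 i₀ - (φ i₀ z - β i₀)) / D with hb_def
  have ha : 0 ≤ a := div_nonneg (by linarith) hDpos.le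
  have hb : 0 ≤ b := div_nonneg (by linarith) hDpos.le
  have hab : a + b = 1 := by
    rw [ha_def, hb_def, ← add_div, div_eq_one_iff_eq hDpos.ne', hD]
    ring
  refine ⟨a • z + b • w, hK hz hw ha hb hab, ?_, ?_, fun i hi => ?_⟩ <;>
    rw [combo_sub_eq _ _ _ _ hab]
  · calc _ ≤ a * M + b * M := add_le_add (mul_le_mul_of_nonneg_left (le_max_left _ _) ha)
          (mul_le_mul_of_nonneg_left (le_max_right _ _) hb)
      _ = M := by rw [← add_mul, hab, one_mul]
      _ ≤ u.1 := h1.le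
  · rw [ha_def, hb_def]
    field_simp
    rw [hD]
    ring
  · nlinarith [h4 i hi, mul_nonneg ha (sub_nonneg.2 (hzi i hi).le),
      mul_nonneg hb (sub_nonneg.2 (hwi i hi).le)]

/-- Lagrange multipliers for minimizing a linear functional over a convex set, subject to one
linear equality and finitely many linear inequalities, under a two-sided Slater condition. -/
theorem exists_multipliers_of_convex (hK : Convex ℝ K) {z w : V} (hz : z ∈ K) (hw : w ∈ K)
    (hz₀ : φ i₀ z < β i₀) (hw₀ : β i₀ < φ i₀ w) (hzi : ∀ i ≠ i₀, φ i z < β i)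
    (hwi : ∀ i ≠ i₀, φ i w < β i)
    (h : ∀ z ∈ K, φ i₀ z = β i₀ → (∀ i ≠ i₀, φ i z ≤ β i) → β₀ ≤ φ₀ z) :
    ∃ t : ι → ℝ, (∀ i ≠ i₀, 0 ≤ t i) ∧
      ∀ z ∈ K, 0 ≤ φ₀ z - β₀ + ∑ i, t i * (φ i z - β i) := by
  obtain ⟨f, hf0, hf⟩ := geometric_hahn_banach_of_nonempty_interior_point
    (convex_valueSet hK) (zero_notMem_interior_valueSet h)
    (interior_valueSet_nonempty hK hz hw hz₀ hw₀ hzi hwi)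
  set g₀ := -f (1, 0) with hg₀_def
  set g : ι → ℝ := fun i => -f (0, Pi.single i 1) with hg_def
  have hfu : ∀ u, f u = -(u.1 * g₀ + ∑ i, u.2 i * g i) := fun u => by
    have := apply_eq_mul_add_sum (f : (ℝ × (ι → ℝ)) →ₗ[ℝ] ℝ) u
    simp only [ContinuousLinearMap.coe_coe] at this
    rw [this]
    simp [hg₀_def, hg_def, add_comm]
  have hval : ∀ v ∈ K, ∀ r, 0 ≤ r → ∀ d : ι → ℝ, d i₀ = 0 → (∀ i, 0 ≤ d i) →
      0 ≤ (φ₀ v - β₀ + r) * g₀ + ∑ i, (φ i v - β i + d i) * g i := by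
    intro v hv r hr d hd hd'
    have := hf (φ₀ v - β₀ + r, fun i => φ i v - β i + d i)
      ⟨v, hv, by simpa using hr, by simp [hd], fun i _ => by simpa using hd' i⟩
    rwa [map_zero, hfu, neg_nonpos] at this
  have hval₀ : ∀ v ∈ K, 0 ≤ (φ₀ v - β₀) * g₀ + ∑ i, (φ i v - β i) * g i := fun v hv => by
    simpa using hval v hv 0 le_rfl 0 rfl (fun _ => le_rfl)
  have hg₀ : 0 ≤ g₀ := by
    refine nonneg_of_forall_add_mul_nonneg
      (S := (φ₀ z - β₀) * g₀ + ∑ i, (φ i z - β i) * g i) fun r hr => ?_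
    have := hval z hz r hr 0 rfl (fun _ => le_rfl)
    simp only [Pi.zero_apply, add_zero] at this
    linarith
  have hg : ∀ i ≠ i₀, 0 ≤ g i := by
    intro i hi
    refine nonneg_of_forall_add_mul_nonneg
      (S := (φ₀ z - β₀) * g₀ + ∑ i, (φ i z - β i) * g i) fun r hr => ?_
    have := hval z hz 0 le_rfl (Pi.single i r) (by simp [hi.symm])
      fun j => by rw [Pi.single_apply]; positivity
    simp only [add_zero, add_mul, Finset.sum_add_distrib, Pi.single_apply, ite_mul, zero_mul,
      Finset.sum_ite_eq', Finset.mem_univ, if_true] at this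
    linarith
  have degenerate : ∀ v ∈ K, φ i₀ v ≠ β i₀ → (∀ i ≠ i₀, φ i v < β i) →
      (φ i₀ v - β i₀) * g i₀ ≤ 0 → g₀ ≠ 0 := by
    intro v hv hv₀ hvi hle h0
    have hterm : ∀ i ∈ Finset.univ, (φ i v - β i) * g i ≤ 0 := fun i _ => by
      rcases eq_or_ne i i₀ with rfl | hi
      · exact hle
      · exact mul_nonpos_of_nonpos_of_nonneg (sub_nonpos.2 (hvi i hi).le) (hg i hi)
    have hsum := hval₀ v hv
    rw [h0, mul_zero, zero_add] at hsum
    have hzero := (Finset.sum_eq_zero_iff_of_nonpos hterm).1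
      (le_antisymm (Finset.sum_nonpos hterm) hsum)
    have hgi : ∀ i, g i = 0 := fun i => by
      refine (mul_eq_zero.1 (hzero i (Finset.mem_univ i))).resolve_left (sub_ne_zero.2 ?_)
      rcases eq_or_ne i i₀ with rfl | hi
      · exact hv₀
      · exact (hvi i hi).ne
    exact hf0 (ContinuousLinearMap.ext fun u => by simp [hfu, h0, hgi])
  have hpos : 0 < g₀ := by
    refine hg₀.lt_of_ne' ?_
    rcases le_total 0 (g i₀) with hi | hi
    · exact degenerate z hz hz₀.ne hzi
        (mul_nonpos_of_nonpos_of_nonneg (sub_nonpos.2 hz₀.le) hi)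
    · exact degenerate w hw hw₀.ne' hwi
        (mul_nonpos_of_nonneg_of_nonpos (sub_nonneg.2 hw₀.le) hi)
  refine ⟨fun i => g i / g₀, fun i hi => div_nonneg (hg i hi) hg₀, fun v hv => ?_⟩
  have := div_nonneg (hval₀ v hv) hg₀
  rw [add_div, mul_div_cancel_right₀ _ hpos.ne', Finset.sum_div] at this
  simpa only [div_mul_eq_mul_div, mul_comm (g _)] using this

end Duality

theorem dotProduct_add_sum_smul_mulVec {n ι : Type*} [Fintype n] [Fintype ι] (B₀ : Matrix n n ℝ)
    (B : ι → Matrix n n ℝ) (t : ι → ℝ) (x : n → ℝ) :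
    x ⬝ᵥ (B₀ + ∑ i, t i • B i) *ᵥ x = x ⬝ᵥ B₀ *ᵥ x + ∑ i, t i * (x ⬝ᵥ B i *ᵥ x) := by
  simp [add_mulVec, sum_mulVec, smul_mulVec, dotProduct_add, dotProduct_sum]

theorem equality_extended_s_lemma (n m : ℕ) (hn : 3 ≤ n) (hm : 1 ≤ m)
    (B₀ : Matrix (Fin n) (Fin n) ℝ) (B : Fin m → Matrix (Fin n) (Fin n) ℝ)
    (A : Fin 3 → Matrix (Fin n) (Fin n) ℝ)
    (hB₀sym : B₀.IsSymm) (hBsym : ∀ i, (B i).IsSymm) (hAsym : ∀ j, (A j).IsSymm)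
    (hgen₀ : ∃ r : Fin 3 → ℝ, B₀ = ∑ j, r j • A j)
    (hgen : ∀ i, ∃ r : Fin 3 → ℝ, B i = ∑ j, r j • A j)
    (hs : ∃ s : Fin 3 → ℝ, (∑ j, s j • A j).PosDef)
    (β₀ : ℝ) (β : Fin m → ℝ)
    (hslater : ∃ xbar : Fin n → ℝ, ∀ i, xbar ⬝ᵥ (B i) *ᵥ xbar < β i)
    (hslater' : ∃ xbar' : Fin n → ℝ,
      β ⟨0, by omega⟩ < xbar' ⬝ᵥ (B ⟨0, by omega⟩) *ᵥ xbar' ∧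
      ∀ i : Fin m, i ≠ ⟨0, by omega⟩ → xbar' ⬝ᵥ (B i) *ᵥ xbar' < β i) :
    (∀ x : Fin n → ℝ,
        x ⬝ᵥ (B ⟨0, by omega⟩) *ᵥ x = β ⟨0, by omega⟩ →
        (∀ i : Fin m, i ≠ ⟨0, by omega⟩ → x ⬝ᵥ (B i) *ᵥ x ≤ β i) →
        β₀ ≤ x ⬝ᵥ B₀ *ᵥ x) ↔
    (∃ t : Fin m → ℝ, (∀ i : Fin m, i ≠ ⟨0, by omega⟩ → 0 ≤ t i) ∧
      (B₀ + ∑ i, t i • B i).PosSemidef ∧ β₀ + ∑ i, t i * β i ≤ 0) := by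
  set i₀ : Fin m := ⟨0, by omega⟩
  constructor
  · intro h
    obtain ⟨r₀, hr₀⟩ := hgen₀
    choose r hr using hgen
    obtain ⟨s, hs⟩ := hs
    obtain ⟨z, hz⟩ := hslater
    obtain ⟨w, hw₀, hw⟩ := hslater'
    have hform₀ : ∀ x, dotProductEquiv ℝ (Fin 3) r₀ (jointForm A x) = x ⬝ᵥ B₀ *ᵥ x := fun x => by
      rw [dotProductEquiv_apply_apply, dotProduct_jointForm, ← hr₀]
    have hform : ∀ i x, dotProductEquiv ℝ (Fin 3) (r i) (jointForm A x) = x ⬝ᵥ B i *ᵥ x :=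
      fun i x => by rw [dotProductEquiv_apply_apply, dotProduct_jointForm, ← hr]
    obtain ⟨t, ht, hK⟩ := exists_multipliers_of_convex (β₀ := β₀) (β := β) (i₀ := i₀)
      (φ₀ := dotProductEquiv ℝ (Fin 3) r₀) (φ := fun i => dotProductEquiv ℝ (Fin 3) (r i))
      (convex_range_jointForm (by rw [Fintype.card_fin]; omega) hAsym hs) ⟨z, rfl⟩ ⟨w, rfl⟩
      (by rw [hform]; exact hz i₀) (by rw [hform]; exact hw₀)
      (fun i _ => by rw [hform]; exact hz i) (fun i hi => by rw [hform]; exact hw i hi)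
      (by
        rintro _ ⟨x, rfl⟩ hx₀ hx
        simp only [hform, hform₀] at hx₀ hx ⊢
        exact h x hx₀ hx)
    have hall : ∀ x, 0 ≤ -(β₀ + ∑ i, t i * β i) + x ⬝ᵥ (B₀ + ∑ i, t i • B i) *ᵥ x := fun x => by
      have hx := hK _ ⟨x, rfl⟩
      simp only [hform, hform₀, mul_sub, Finset.sum_sub_distrib] at hx
      rw [dotProduct_add_sum_smul_mulVec]
      linarith
    refine ⟨t, ht, posSemidef_iff_dotProduct_mulVec.2 ⟨?_, fun x => ?_⟩, ?_⟩
    · simp [IsHermitian, hB₀sym.eq, fun i => (hBsym i).eq, transpose_sum]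
    · refine nonneg_of_forall_add_mul_nonneg (S := -(β₀ + ∑ i, t i * β i)) fun c hc => ?_
      have hx := hall (√c • x)
      rwa [mulVec_smul, dotProduct_smul, smul_dotProduct, smul_smul, Real.mul_self_sqrt hc] at hx
    · have hx := hall 0
      rw [mulVec_zero, dotProduct_zero] at hx
      linarith
  · rintro ⟨t, ht, hpsd, hβ⟩ x hx₀ hx
    have hnonneg := (posSemidef_iff_dotProduct_mulVec.1 hpsd).2 x
    rw [star_trivial, dotProduct_add_sum_smul_mulVec] at hnonneg
    have hle : ∑ i, t i * (x ⬝ᵥ B i *ᵥ x) ≤ ∑ i, t i * β i := Finset.sum_le_sum fun i _ => by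
      rcases eq_or_ne i i₀ with rfl | hi
      · rw [hx₀]
      · exact mul_le_mul_of_nonneg_left (hx i hi) (ht i hi)
    linarith
end

section
/- Let x* be a local minimizer of a nonlinear program min f subject to gᵢ ≤ 0, hⱼ = 0 at which MFCQ holds, and let (λ¹,μ¹), …, (λᵐ,μᵐ) be the vertices of the (polyhedral, bounded) Lagrange multiplier set Λ(x*). Suppose the Hessians ∇²L(x*, λⁱ, μⁱ), i = 1,…,m, are all real linear combinations of three symmetric matrices A₁, A₂, A₃ with s₁A₁ + s₂A₂ + s₃A₃ positive definite for some reals s₁, s₂, s₃. Then for every regular cone K contained in the critical cone C(x*) with dim(span K) ≥ 3, there exists a single Lagrange multiplier (λ,μ) ∈ Λ(x*) such that vᵀ∇²L(x*,λ,μ)v ≥ 0 for all v ∈ K. -/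
open Matrix

section QuadraticTriple

open LinearMap (BilinForm)

theorem exists_ne_zero_common_kernel {W : Type*} [AddCommGroup W] [Module ℝ W]
    [FiniteDimensional ℝ W] (hW : 3 ≤ Module.finrank ℝ W) (a b : W →ₗ[ℝ] ℝ) :
    ∃ z : W, z ≠ 0 ∧ a z = 0 ∧ b z = 0 := by
  have hlt : Module.finrank ℝ (ℝ × ℝ) < Module.finrank ℝ W := by
    rw [Module.finrank_prod, Module.finrank_self]
    omega
  obtain ⟨z, hz, hz0⟩ := (Submodule.ne_bot_iff _).1
    (LinearMap.ker_ne_bot_of_finrank_lt (f := a.prod b) hlt)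
  rw [LinearMap.mem_ker, LinearMap.prod_apply] at hz
  exact ⟨z, hz0, congrArg Prod.fst hz, congrArg Prod.snd hz⟩

section BilinForm

variable {W : Type*} [AddCommGroup W] [Module ℝ W] (q D : BilinForm ℝ W)

theorem exists_common_zero_of_curve (γ : ℝ → W) (hγ : ∀ t ∈ Set.Icc (0 : ℝ) 1, γ t ≠ 0)
    (hq : ∀ t ∈ Set.Icc (0 : ℝ) 1, q (γ t) (γ t) = 0)
    (hc : Continuous fun t => D (γ t) (γ t))
    (h0 : D (γ 0) (γ 0) ≤ 0) (h1 : 0 ≤ D (γ 1) (γ 1)) :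
    ∃ z ≠ 0, q z z = 0 ∧ D z z = 0 := by
  obtain ⟨t, ht, hDt⟩ := intermediate_value_Icc zero_le_one hc.continuousOn ⟨h0, h1⟩
  exact ⟨γ t, hγ t ht, hq t ht, hDt⟩

theorem exists_common_zero_of_orthogonal (hq : q.IsSymm) {x y : W} (hx : x ≠ 0) (hy : y ≠ 0)
    (hqx : q x x = 0) (hqy : q y y = 0) (hxy : q x y = 0)
    (hDx : D x x ≤ 0) (hDy : 0 ≤ D y y) : ∃ z ≠ 0, q z z = 0 ∧ D z z = 0 := by
  have hyx : q y x = 0 := hq.eq y x ▸ hxy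
  by_cases hind : LinearIndependent ℝ ![x, y]
  · refine exists_common_zero_of_curve q D (fun t => (1 - t) • x + t • y) ?_ ?_ ?_ ?_ ?_
    · intro t _ h
      have := LinearIndependent.pair_iff.1 hind _ _ h
      linarith [this.1, this.2]
    · intro t _
      simp [hqx, hqy, hxy, hyx]
    · simp only [map_add, map_smul, LinearMap.add_apply, LinearMap.smul_apply, smul_eq_mul]
      fun_prop
    · simpa using hDx
    · simpa using hDy
  · rw [LinearIndependent.pair_iff' hx] at hind
    push Not at hind
    obtain ⟨c, rfl⟩ := hind
    refine ⟨x, hx, hqx, le_antisymm hDx ?_⟩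
    have hc : c ≠ 0 := by rintro rfl; simp at hy
    simp only [map_smul, LinearMap.smul_apply, smul_eq_mul, ← mul_assoc] at hDy
    exact nonneg_of_mul_nonneg_right hDy (mul_self_pos.2 hc)

theorem exists_common_zero [FiniteDimensional ℝ W] (hW : 3 ≤ Module.finrank ℝ W)
    (hq : q.IsSymm) {x y : W} (hx : x ≠ 0) (hy : y ≠ 0)
    (hqx : q x x = 0) (hqy : q y y = 0)
    (hDx : D x x ≤ 0) (hDy : 0 ≤ D y y) : ∃ z ≠ 0, q z z = 0 ∧ D z z = 0 := by
  by_cases hxy : q x y = 0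
  · exact exists_common_zero_of_orthogonal q D hq hx hy hqx hqy hxy hDx hDy
  obtain ⟨z, hz, hxz, hyz⟩ := exists_ne_zero_common_kernel hW (q x) (q y)
  have hzx : q z x = 0 := (hq.eq z x).trans hxz
  have hzy : q z y = 0 := (hq.eq z y).trans hyz
  rcases eq_or_ne (q z z) 0 with hc | hc
  · rcases le_total 0 (D z z) with h | h
    · exact exists_common_zero_of_orthogonal q D hq hx hz hqx hc hxz hDx h
    · exact exists_common_zero_of_orthogonal q D hq hz hy hc hqy hzy h hDy
  -- after changing the sign of `y`, `q x y` and `q z z` have opposite signs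
  wlog hneg : q x y * q z z < 0 generalizing y
  · refine this (y := -y) (neg_ne_zero.2 hy) (by simpa using hqy) (by simpa using hDy)
      (by simpa using hxy) (by simpa using hyz) (by simpa using hzy) ?_
    have : q x y * q z z ≠ 0 := mul_ne_zero hxy hc
    have := lt_of_le_of_ne (not_lt.1 hneg) this.symm
    simpa using this
  have hyx : q y x = q x y := hq.eq y x
  have hk : 0 < -(q x y / q z z) := by
    rw [neg_pos, ← mul_div_mul_right _ _ hc]
    exact div_neg_of_neg_of_pos hneg (mul_self_pos.2 hc)
  refine exists_common_zero_of_curve q D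
    (fun t => (1 - t) • x + t • y + √(2 * (1 - t) * t * -(q x y / q z z)) • z) ?_ ?_ ?_ ?_ ?_
  · intro t _ h
    have h1 := congrArg (q x) h
    have h2 := congrArg (q y) h
    simp only [map_add, map_smul, smul_eq_mul, hqx, hqy, hxz, hyz, hyx, map_zero, mul_zero,
      zero_add, add_zero, mul_eq_zero, hxy, or_false] at h1 h2
    linarith
  · intro t ht
    have hs := Real.mul_self_sqrt (x := 2 * (1 - t) * t * -(q x y / q z z))
      (mul_nonneg (mul_nonneg (by linarith [ht.2]) ht.1) hk.le)
    simp only [map_add, map_smul, LinearMap.add_apply, LinearMap.smul_apply, smul_eq_mul,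
      hqx, hqy, hxz, hyz, hzx, hzy, hyx, mul_zero, zero_add, add_zero]
    rw [← mul_assoc (√_), hs]
    field_simp
    ring
  · simp only [map_add, map_smul, LinearMap.add_apply, LinearMap.smul_apply, smul_eq_mul]
    fun_prop
  · simpa using hDx
  · simpa using hDy

/-- Joint range of three quadratic forms with a positive definite combination is convex. -/
theorem convex_range_quadratic_triple [FiniteDimensional ℝ W] (hW : 3 ≤ Module.finrank ℝ W)
    (B : Fin 3 → BilinForm ℝ W) (hB : ∀ j, (B j).IsSymm) (s : Fin 3 → ℝ)
    (hs : ∀ x ≠ 0, 0 < ∑ j, s j * B j x x) :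
    Convex ℝ (Set.range fun x j => B j x x) := by
  have hscale (a : ℝ) (ha : 0 ≤ a) (x : W) :
      (fun j => B j (√a • x) (√a • x)) = a • fun j => B j x x := by
    ext j
    simp only [map_smul, LinearMap.smul_apply, smul_eq_mul, Pi.smul_apply]
    rw [← mul_assoc, Real.mul_self_sqrt ha]
  suffices hadd : ∀ x y : W, ∃ z, (fun j => B j z z) = (fun j => B j x x) + fun j => B j y y by
    rintro _ ⟨x, rfl⟩ _ ⟨y, rfl⟩ a b ha hb -
    obtain ⟨z, hz⟩ := hadd (√a • x) (√b • y)
    exact ⟨z, by simpa only [hscale a ha, hscale b hb] using hz⟩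
  intro x y
  rcases eq_or_ne x 0 with rfl | hx
  · exact ⟨y, by ext; simp⟩
  rcases eq_or_ne y 0 with rfl | hy
  · exact ⟨x, by ext; simp⟩
  set X : Fin 3 → ℝ := fun j => B j x x with hX
  set Y : Fin 3 → ℝ := fun j => B j y y with hY
  set T : Fin 3 → ℝ := X + Y with hT
  have hTpos : 0 < s ⬝ᵥ T := by
    rw [hT, dotProduct_add]
    exact add_pos (hs x hx) (hs y hy)
  obtain ⟨l, hl, hlX, hlT⟩ := exists_ne_zero_common_kernel (W := Fin 3 → ℝ) (by simp)
    (dotProductBilin ℝ ℝ X) (dotProductBilin ℝ ℝ T)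
  replace hlX : X ⬝ᵥ l = 0 := hlX
  replace hlT : l ⬝ᵥ T = 0 := (dotProduct_comm _ _).trans hlT
  have hlY : Y ⬝ᵥ l = 0 := by
    rw [hT, dotProduct_add, dotProduct_comm l X, hlX, zero_add] at hlT
    rw [dotProduct_comm, hlT]
  have hform (c : Fin 3 → ℝ) (x : W) :
      (∑ j, c j • B j) x x = (fun j => B j x x) ⬝ᵥ c := by
    simp [dotProduct, LinearMap.sum_apply, mul_comm]
  have hsymm : (∑ j, l j • B j).IsSymm :=
    ⟨fun u v => by simp [LinearMap.sum_apply, (hB _).eq u v]⟩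
  obtain ⟨m, hmT, hm⟩ : ∃ m : Fin 3 → ℝ, T ⬝ᵥ m = 0 ∧
      ∀ Z : Fin 3 → ℝ, Z ⬝ᵥ m = 0 → l ⬝ᵥ (T ⨯₃ Z) = 0 := by
    refine ⟨l ⨯₃ T, dot_cross_self _ _, fun Z hZ => ?_⟩
    rw [← triple_product_permutation, hZ]
  obtain ⟨z, hz, hlz, hmz⟩ : ∃ z ≠ 0, (fun j => B j z z) ⬝ᵥ l = 0 ∧
      (fun j => B j z z) ⬝ᵥ m = 0 := by
    rw [hT, add_dotProduct] at hmT
    simp only [← hform]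
    rcases le_total (X ⬝ᵥ m) 0 with h | h
    · exact exists_common_zero _ _ hW hsymm hx hy (by rw [hform]; exact hlX)
        (by rw [hform]; exact hlY) (by rw [hform]; exact h)
        (by rw [hform]; change 0 ≤ Y ⬝ᵥ m; linarith)
    · exact exists_common_zero _ _ hW hsymm hy hx (by rw [hform]; exact hlY)
        (by rw [hform]; exact hlX) (by rw [hform]; change Y ⬝ᵥ m ≤ 0; linarith)
        (by rw [hform]; exact h)
  set Z : Fin 3 → ℝ := fun j => B j z z with hZ
  have hZpos : 0 < s ⬝ᵥ Z := hs z hz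
  have hcross : T ⨯₃ Z = 0 := by
    have h1 : l ⨯₃ (T ⨯₃ Z) = 0 := by
      rw [cross_cross_eq_smul_sub_smul', dotProduct_comm T l, hlT, dotProduct_comm l Z, hlz]
      simp
    have h2 := cross_cross_eq_smul_sub_smul' l l (T ⨯₃ Z)
    rw [h1, hm Z hmz, map_zero, zero_smul, zero_sub, eq_comm, neg_eq_zero, smul_eq_zero] at h2
    exact h2.resolve_left fun h => hl (dotProduct_self_eq_zero.1 h)
  have hpar : (s ⬝ᵥ Z) • T = (s ⬝ᵥ T) • Z := by
    have := cross_cross_eq_smul_sub_smul' s T Z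
    rw [hcross, map_zero, eq_comm, sub_eq_zero, dotProduct_comm T] at this
    exact this
  refine ⟨√(s ⬝ᵥ T / s ⬝ᵥ Z) • z, ?_⟩
  rw [hscale _ (div_pos hTpos hZpos).le, ← hZ, div_eq_inv_mul, mul_smul, ← hpar,
    inv_smul_smul₀ hZpos.ne']

end BilinForm

end QuadraticTriple

theorem Convex.exists_nonneg_weights {ι : Type*} [Fintype ι] {C : Set (ι → ℝ)}
    (hC : Convex ℝ C) (hne : C.Nonempty) (hneg : ∀ y ∈ C, ∃ i, 0 ≤ y i) :
    ∃ t : ι → ℝ, (∀ i, 0 ≤ t i) ∧ ∑ i, t i = 1 ∧ ∀ y ∈ C, 0 ≤ ∑ i, t i * y i := by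
  classical
  have hopen : IsOpen (Set.univ.pi fun _ : ι => Set.Iio (0 : ℝ)) :=
    isOpen_set_pi Set.finite_univ fun _ _ => isOpen_Iio
  have hconv : Convex ℝ (Set.univ.pi fun _ : ι => Set.Iio (0 : ℝ)) :=
    convex_pi fun _ _ => convex_Iio 0
  obtain ⟨f, u, hfu, huf⟩ := geometric_hahn_banach_open hconv hopen hC (by
    rw [Set.disjoint_left]
    intro y hy hyC
    obtain ⟨i, hi⟩ := hneg y hyC
    exact absurd (hy i (Set.mem_univ i)) (not_lt.2 hi))
  have hf (y : ι → ℝ) : f y = ∑ i, f (Pi.single i 1) * y i := by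
    conv_lhs => rw [pi_eq_sum_univ' y]
    simp [mul_comm]
  have hray (y : ι → ℝ) (hy : ∀ i, y i ≤ 0) (s : ℝ) (hs : 0 < s) : f y ≤ s * (u + f 1) := by
    have h1 := hfu (s⁻¹ • y - 1) fun i _ => by
      have := mul_nonpos_of_nonneg_of_nonpos (inv_nonneg.2 hs.le) (hy i)
      simp only [Pi.sub_apply, Pi.smul_apply, smul_eq_mul, Pi.one_apply, Set.mem_Iio]
      linarith
    rw [map_sub, map_smul, smul_eq_mul, sub_lt_iff_lt_add, inv_mul_lt_iff₀ hs] at h1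
    exact h1.le
  have hnonpos (y : ι → ℝ) (hy : ∀ i, y i ≤ 0) : f y ≤ 0 := by
    refine le_of_forall_pos_le_add fun ε hε => ?_
    rcases le_or_gt (u + f 1) 0 with h | h
    · have := hray y hy 1 one_pos
      linarith
    · have := hray y hy (ε / (u + f 1)) (div_pos hε h)
      rw [div_mul_cancel₀ _ h.ne'] at this
      linarith
  have hcoef (i : ι) : 0 ≤ f (Pi.single i 1) := by
    have := hnonpos (-Pi.single i 1) fun j => by
      rw [Pi.neg_apply, neg_nonpos, Pi.single_apply]
      split_ifs <;> norm_num
    rwa [map_neg, neg_nonpos] at this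
  have hu : 0 ≤ u := by
    by_contra! hlt
    obtain ⟨s, hs, hsu⟩ : ∃ s > 0, -(s * f 1) = u / 2 ∨ f 1 = 0 := by
      rcases (hf 1 ▸ Finset.sum_nonneg fun i _ => by simpa using hcoef i : 0 ≤ f 1).eq_or_lt
        with h | h
      · exact ⟨1, one_pos, Or.inr h.symm⟩
      · exact ⟨-u / 2 / f 1, div_pos (by linarith) h, Or.inl (by field_simp)⟩
    have := hfu (-(s • 1)) fun i _ => by simpa using hs
    rw [map_neg, map_smul, smul_eq_mul] at this
    rcases hsu with h | h
    · linarith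
    · rw [h] at this; linarith
  have hsum : 0 < ∑ i, f (Pi.single i 1) := by
    refine (Finset.sum_nonneg fun i _ => hcoef i).lt_of_ne' fun h => ?_
    rw [Finset.sum_eq_zero_iff_of_nonneg fun i _ => hcoef i] at h
    have hzero (y : ι → ℝ) : f y = 0 := by
      rw [hf]
      exact Finset.sum_eq_zero fun i hi => by rw [h i hi, zero_mul]
    obtain ⟨y, hy⟩ := hne
    have h1 := hfu (-1) fun i _ => by simp
    have h2 := huf y hy
    rw [hzero] at h1 h2
    linarith
  refine ⟨fun i => (∑ i, f (Pi.single i 1))⁻¹ * f (Pi.single i 1),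
    fun i => mul_nonneg (inv_nonneg.2 hsum.le) (hcoef i), ?_, fun y hy => ?_⟩
  · rw [← Finset.mul_sum, inv_mul_cancel₀ hsum.ne']
  · simp only [mul_assoc]
    rw [← Finset.mul_sum, ← hf]
    exact mul_nonneg (inv_nonneg.2 hsum.le) (hu.trans (huf y hy))

theorem LinearIndependent.exists_forall_apply_eq {E κ : Type*} [AddCommGroup E] [Module ℝ E]
    [Fintype κ] {b : κ → E →ₗ[ℝ] ℝ} (hb : LinearIndependent ℝ b) (d : κ → ℝ) :
    ∃ w, ∀ j, b j w = d j := by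
  classical
  suffices LinearMap.range (LinearMap.pi b) = ⊤ by
    obtain ⟨w, hw⟩ := LinearMap.range_eq_top.1 this d
    exact ⟨w, fun j => congrFun hw j⟩
  by_contra hne
  obtain ⟨φ, hφ, hle⟩ := Submodule.exists_le_ker_of_lt_top _ (lt_top_iff_ne_top.2 hne)
  refine hφ (LinearMap.pi_ext' fun j => LinearMap.ext_ring ?_)
  refine Fintype.linearIndependent_iff.1 hb (fun j => φ (Pi.single j 1)) ?_ j
  ext w
  have := hle (LinearMap.mem_range_self _ w)
  rw [LinearMap.mem_ker, pi_eq_sum_univ' (LinearMap.pi b w)] at this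
  simpa [mul_comm] using this

/-- An inhomogeneous form of the Motzkin transposition theorem. -/
theorem exists_multipliers_of_not_feasible {E ι κ : Type*} [AddCommGroup E] [Module ℝ E]
    [Fintype ι] [Fintype κ] (a : ι → E →ₗ[ℝ] ℝ) (c : ι → ℝ) {b : κ → E →ₗ[ℝ] ℝ}
    (hb : LinearIndependent ℝ b) (d : κ → ℝ)
    (hinf : ∀ w, (∀ j, b j w + d j = 0) → ∃ i, 0 ≤ a i w + c i) :
    ∃ (t : ι → ℝ) (r : κ → ℝ), (∀ i, 0 ≤ t i) ∧ ∑ i, t i = 1 ∧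
      ∑ i, t i • a i + ∑ j, r j • b j = 0 ∧ 0 ≤ ∑ i, t i * c i + ∑ j, r j * d j := by
  obtain ⟨w₀, hw₀⟩ := hb.exists_forall_apply_eq fun j => -d j
  obtain ⟨t, ht, ht1, htC⟩ := Convex.exists_nonneg_weights
    (C := (fun w i => a i w + c i) '' {w | ∀ j, b j w + d j = 0}) (by
      rintro _ ⟨w, hw, rfl⟩ _ ⟨w', hw', rfl⟩ α β - - hαβ
      refine ⟨α • w + β • w', fun j => ?_, ?_⟩
      · have h1 := hw j
        have h2 := hw' j
        simp only [map_add, map_smul, smul_eq_mul]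
        linear_combination α * h1 + β * h2 - d j * hαβ
      · ext i
        simp only [map_add, map_smul, smul_eq_mul, Pi.add_apply, Pi.smul_apply]
        linear_combination -c i * hαβ)
    ⟨_, w₀, fun j => by rw [hw₀ j, neg_add_cancel], rfl⟩
    (by rintro _ ⟨w, hw, rfl⟩; exact hinf w hw)
  have hval (w : E) (hw : ∀ j, b j w + d j = 0) :
      0 ≤ (∑ i, t i • a i) w + ∑ i, t i * c i := by
    have := htC _ ⟨w, hw, rfl⟩
    simpa [mul_add, Finset.sum_add_distrib] using this
  have hker : ⨅ j, LinearMap.ker (b j) ≤ LinearMap.ker (∑ i, t i • a i) := by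
    intro k hk
    simp only [Submodule.mem_iInf, LinearMap.mem_ker] at hk
    rw [LinearMap.mem_ker]
    set M := ∑ i, t i • a i
    by_contra hMk
    have := hval (w₀ - ((M w₀ + ∑ i, t i * c i + 1) / M k) • k) fun j => by
      rw [map_sub, map_smul, hk j, hw₀ j]; simp
    rw [map_sub, map_smul, smul_eq_mul, div_mul_cancel₀ _ hMk] at this
    linarith
  obtain ⟨r, hr⟩ := (Submodule.mem_span_range_iff_exists_fun ℝ).1 (mem_span_of_iInf_ker_le_ker hker)
  refine ⟨t, fun j => -r j, ht, ht1, ?_, ?_⟩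
  · rw [← hr, ← Finset.sum_add_distrib]
    exact Finset.sum_eq_zero fun j _ => by rw [← add_smul, add_neg_cancel, zero_smul]
  · have := hval w₀ fun j => by rw [hw₀ j, neg_add_cancel]
    rw [← hr] at this
    simp only [LinearMap.sum_apply, LinearMap.smul_apply, hw₀, smul_eq_mul, mul_neg] at this
    simp only [neg_mul]
    rwa [add_comm]

section SecondOrder

open Asymptotics Filter Topology

section Curve

variable {E F : Type*} [NormedAddCommGroup E] [NormedSpace ℝ E]
  [NormedAddCommGroup F] [NormedSpace ℝ F]

theorem HasStrictFDerivAt.exists_correction [CompleteSpace E] [CompleteSpace F] {h : E → F}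
    {h' : E →L[ℝ] F} {a : E} (hh : HasStrictFDerivAt h h' a) (hsurj : h'.range = ⊤) :
    ∃ M : ℝ, ∀ᶠ y in 𝓝 a, ∃ z, h z = h a ∧ ‖z - y‖ ≤ M * ‖h y - h a‖ := by
  have hN := h'.nonlinearRightInverseOfSurjective_nnnorm_pos hsurj
  set R := h'.nonlinearRightInverseOfSurjective hsurj
  obtain ⟨s, hs, happ⟩ := hh.approximates_deriv_on_nhds (c := R.nnnorm⁻¹ / 2)
    (Or.inr (half_pos (inv_pos.2 hN)))
  obtain ⟨ε, hε, hεs⟩ := Metric.mem_nhds_iff.1 hs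
  refine ⟨2 * R.nnnorm, ?_⟩
  have hcont : Tendsto (fun y => dist y a + 2 * R.nnnorm * ‖h y - h a‖) (𝓝 a) (𝓝 0) := by
    have h1 : ContinuousAt (fun y => dist y a + 2 * R.nnnorm * ‖h y - h a‖) a := by
      have := hh.continuousAt
      fun_prop
    simpa [ContinuousAt] using h1
  filter_upwards [hcont.eventually_lt_const hε] with y hy
  have hsub : Metric.closedBall y (2 * R.nnnorm * ‖h y - h a‖) ⊆ s := by
    refine Set.Subset.trans (fun z hz => ?_) hεs
    rw [Metric.mem_closedBall] at hz
    rw [Metric.mem_ball]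
    linarith [dist_triangle z y a]
  obtain ⟨z, hz, hza⟩ := happ.surjOn_closedBall_of_nonlinearRightInverse R (by positivity) hsub
    (show h a ∈ _ by
      rw [Metric.mem_closedBall, dist_comm, dist_eq_norm]
      refine le_of_eq ?_
      have : (R.nnnorm : ℝ) ≠ 0 := by exact_mod_cast hN.ne'
      push_cast
      field_simp
      ring)
  exact ⟨z, hza, by rwa [Metric.mem_closedBall, dist_eq_norm] at hz⟩

theorem hasDerivAt_parabola (a v w : E) (t : ℝ) :
    HasDerivAt (fun t : ℝ => a + t • v + (t ^ 2 / 2) • w) (v + t • w) t := by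
  have h1 := (((hasDerivAt_id t).smul_const v).const_add a).add
    ((((hasDerivAt_id t).pow 2).div_const 2).smul_const w)
  simpa [Pi.add_def] using h1

theorem ContDiff.taylor_two_parabola {φ : E → ℝ} (hφ : ContDiff ℝ 2 φ) (a v w : E) :
    (fun t : ℝ => φ (a + t • v + (t ^ 2 / 2) • w) -
      (φ a + t * fderiv ℝ φ a v +
        t ^ 2 / 2 * (fderiv ℝ φ a w + iteratedFDeriv ℝ 2 φ a ![v, v]))) =o[𝓝 0]
      fun t => t ^ 2 := by
  have hy : ContDiff ℝ 2 fun t : ℝ => a + t • v + (t ^ 2 / 2) • w := by fun_prop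
  have hd : deriv (fun t : ℝ => φ (a + t • v + (t ^ 2 / 2) • w)) =
      fun t => fderiv ℝ φ (a + t • v + (t ^ 2 / 2) • w) (v + t • w) := by
    ext t
    exact ((hφ.differentiable two_ne_zero _).hasFDerivAt.comp_hasDerivAt t
      (hasDerivAt_parabola a v w t)).deriv
  have hd2 : deriv (deriv fun t : ℝ => φ (a + t • v + (t ^ 2 / 2) • w)) 0 =
      fderiv ℝ φ a w + iteratedFDeriv ℝ 2 φ a ![v, v] := by
    rw [hd]
    have hf1 : ContDiff ℝ 1 (fderiv ℝ φ) := hφ.fderiv_right (by norm_num)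
    have h1 := ((hf1.differentiable one_ne_zero _).hasFDerivAt.comp_hasDerivAt (0 : ℝ)
      (hasDerivAt_parabola a v w 0)).clm_apply (((hasDerivAt_id (0 : ℝ)).smul_const w).const_add v)
    rw [iteratedFDeriv_two_apply]
    simpa [add_comm] using h1.deriv
  have := taylor_isLittleO_univ (x₀ := 0) (hφ.comp hy)
  refine this.congr' (Eventually.of_forall fun t => ?_) (Eventually.of_forall fun t => by simp)
  simp only [taylorWithinEval_succ, taylor_within_zero_eval, iteratedDerivWithin_univ,
    iteratedDeriv_succ, iteratedDeriv_zero, Function.comp_def, zero_add, hd2]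
  rw [hd]
  simp only [Nat.factorial, zero_smul, add_zero, smul_eq_mul, sub_zero, ne_eq, OfNat.ofNat_ne_zero,
    not_false_eq_true, zero_pow, zero_div, Nat.cast_zero, Nat.cast_one]
  ring

variable {a v w : E} {c : ℝ → E}

theorem ContDiff.taylor_two_curve {φ : E → ℝ} (hφ : ContDiff ℝ 2 φ)
    (hc : (fun t : ℝ => c t - (a + t • v + (t ^ 2 / 2) • w)) =o[𝓝 0] fun t => t ^ 2) :
    (fun t : ℝ => φ (c t) - (φ a + t * fderiv ℝ φ a v +
        t ^ 2 / 2 * (fderiv ℝ φ a w + iteratedFDeriv ℝ 2 φ a ![v, v]))) =o[𝓝 0]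
      fun t => t ^ 2 := by
  have hy : Tendsto (fun t : ℝ => a + t • v + (t ^ 2 / 2) • w) (𝓝 0) (𝓝 a) := by
    simpa using (hasDerivAt_parabola a v w 0).continuousAt.tendsto
  have hca : Tendsto c (𝓝 0) (𝓝 a) := by
    have h0 : Tendsto (fun t : ℝ => t ^ 2) (𝓝 0) (𝓝 0) := by
      simpa using (continuous_pow 2).tendsto (0 : ℝ)
    simpa using (hc.trans_tendsto h0).add hy
  have hlip := ((hφ.contDiffAt.hasStrictFDerivAt two_ne_zero).isBigO_sub).comp_tendsto
    (hca.prodMk_nhds hy)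
  simpa [Function.comp_def] using (hlip.trans_isLittleO hc).add (hφ.taylor_two_parabola a v w)

theorem ContDiff.eventually_lt_along_curve {φ : E → ℝ} (hφ : ContDiff ℝ 2 φ)
    (hc : (fun t : ℝ => c t - (a + t • v + (t ^ 2 / 2) • w)) =o[𝓝 0] fun t => t ^ 2)
    (hdesc : fderiv ℝ φ a v < 0 ∨
      fderiv ℝ φ a v = 0 ∧ fderiv ℝ φ a w + iteratedFDeriv ℝ 2 φ a ![v, v] < 0) :
    ∀ᶠ t in 𝓝[>] 0, φ (c t) < φ a := by
  have ht := hφ.taylor_two_curve hc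
  set α := fderiv ℝ φ a v
  set β := fderiv ℝ φ a w + iteratedFDeriv ℝ 2 φ a ![v, v]
  rcases hdesc with hα | ⟨hα, hβ⟩
  · have hsmall : ∀ᶠ t : ℝ in 𝓝 0, α + t * (β / 2 + 1) < 0 := by
      have : Tendsto (fun t : ℝ => α + t * (β / 2 + 1)) (𝓝 0) (𝓝 (α + 0 * (β / 2 + 1))) :=
        Continuous.tendsto (by fun_prop) _
      exact this.eventually_lt_const (by simpa using hα)
    filter_upwards [nhdsWithin_le_nhds (ht.def one_pos), nhdsWithin_le_nhds hsmall,
      self_mem_nhdsWithin] with t h1 h2 h3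
    rw [Real.norm_eq_abs, Real.norm_eq_abs, abs_of_nonneg (sq_nonneg t)] at h1
    nlinarith [le_abs_self (φ (c t) - (φ a + t * α + t ^ 2 / 2 * β)), mul_neg_of_pos_of_neg h3 h2]
  · filter_upwards [nhdsWithin_le_nhds (ht.def (show 0 < -β / 4 by linarith)),
      self_mem_nhdsWithin] with t h1 h3
    rw [Real.norm_eq_abs, Real.norm_eq_abs, abs_of_nonneg (sq_nonneg t), hα] at h1
    nlinarith [le_abs_self (φ (c t) - (φ a + t * 0 + t ^ 2 / 2 * β)),
      mul_neg_of_pos_of_neg (pow_pos h3 2) hβ]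

theorem LinearIndependent.coe_linearMap {κ : Type*} {b : κ → E →L[ℝ] ℝ}
    (hb : LinearIndependent ℝ b) : LinearIndependent ℝ fun j => (b j : E →ₗ[ℝ] ℝ) :=
  hb.map' (ContinuousLinearMap.coeLM ℝ)
    (LinearMap.ker_eq_bot.2 ContinuousLinearMap.coe_injective)

theorem exists_curve_mem_zero_set [CompleteSpace E] {κ : Type*} [Fintype κ] {h : κ → E → ℝ}
    (hh : ∀ j, ContDiff ℝ 2 (h j)) (hli : LinearIndependent ℝ fun j => fderiv ℝ (h j) a)
    (h0 : ∀ j, h j a = 0) (hv : ∀ j, fderiv ℝ (h j) a v = 0)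
    (hw : ∀ j, fderiv ℝ (h j) a w + iteratedFDeriv ℝ 2 (h j) a ![v, v] = 0) :
    ∃ c : ℝ → E, (fun t : ℝ => c t - (a + t • v + (t ^ 2 / 2) • w)) =o[𝓝 0] (fun t => t ^ 2) ∧
      ∀ᶠ t in 𝓝 0, ∀ j, h j (c t) = 0 := by
  have hstrict : HasStrictFDerivAt (fun x j => h j x)
      (ContinuousLinearMap.pi fun j => fderiv ℝ (h j) a) a :=
    hasStrictFDerivAt_pi.2 fun j => (hh j).contDiffAt.hasStrictFDerivAt two_ne_zero
  have hsurj : (ContinuousLinearMap.pi fun j => fderiv ℝ (h j) a).range = ⊤ := by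
    refine LinearMap.range_eq_top.2 fun d => ?_
    obtain ⟨x, hx⟩ := hli.coe_linearMap.exists_forall_apply_eq d
    exact ⟨x, funext hx⟩
  obtain ⟨M, hM⟩ := hstrict.exists_correction hsurj
  have hy : Tendsto (fun t : ℝ => a + t • v + (t ^ 2 / 2) • w) (𝓝 0) (𝓝 a) := by
    simpa using (hasDerivAt_parabola a v w 0).continuousAt.tendsto
  obtain ⟨c, hc⟩ := (hy.eventually hM).choice
  refine ⟨c, ?_, hc.mono fun t ht j => (congrFun ht.1 j).trans (h0 j)⟩
  refine (IsBigO.of_bound M (hc.mono fun t ht => ht.2)).trans_isLittleO ?_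
  refine isLittleO_pi.2 fun j => ?_
  simpa [h0 j, hv j, hw j] using (hh j).taylor_two_parabola a v w

end Curve

section Multipliers

variable {E : Type*} [NormedAddCommGroup E] [NormedSpace ℝ E] {ι κ : Type*} [Fintype ι]
  [Fintype κ] {f : E → ℝ} {g : ι → E → ℝ} {h : κ → E → ℝ} {x : E}

theorem exists_multiplier_of_isLocalMinOn_of_fderiv_eq_zero [CompleteSpace E]
    (hf : ContDiff ℝ 2 f) (hg : ∀ i, ContDiff ℝ 2 (g i)) (hh : ∀ j, ContDiff ℝ 2 (h j))
    (hgx : ∀ i, g i x ≤ 0) (hhx : ∀ j, h j x = 0)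
    (hmin : IsLocalMinOn f {y | (∀ i, g i y ≤ 0) ∧ ∀ j, h j y = 0} x)
    (hli : LinearIndependent ℝ fun j => fderiv ℝ (h j) x)
    (hu : ∃ u, (∀ i, g i x = 0 → fderiv ℝ (g i) x u < 0) ∧ ∀ j, fderiv ℝ (h j) x u = 0)
    {v : E} (hfv : fderiv ℝ f x v = 0) (hgv : ∀ i, g i x = 0 → fderiv ℝ (g i) x v ≤ 0)
    (hhv : ∀ j, fderiv ℝ (h j) x v = 0) :
    ∃ (l : ι → ℝ) (r : κ → ℝ), (∀ i, 0 ≤ l i) ∧ (∀ i, l i * g i x = 0) ∧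
      fderiv ℝ f x + ∑ i, l i • fderiv ℝ (g i) x + ∑ j, r j • fderiv ℝ (h j) x = 0 ∧
      0 ≤ iteratedFDeriv ℝ 2 f x ![v, v] + ∑ i, l i * iteratedFDeriv ℝ 2 (g i) x ![v, v] +
        ∑ j, r j * iteratedFDeriv ℝ 2 (h j) x ![v, v] := by
  classical
  let P : ι → Prop := fun i => g i x = 0 ∧ fderiv ℝ (g i) x v = 0
  let φ : Option {i // P i} → E → ℝ := fun o => o.elim f fun i => g i
  have hφ : ∀ o, ContDiff ℝ 2 (φ o) := by
    rintro (_ | i)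
    exacts [hf, hg i]
  have hφv : ∀ o, fderiv ℝ (φ o) x v = 0 := by
    rintro (_ | i)
    exacts [hfv, i.2.2]
  obtain ⟨t, r, ht, ht1, hstat, hcurv⟩ := exists_multipliers_of_not_feasible
    (fun o => (fderiv ℝ (φ o) x : E →ₗ[ℝ] ℝ)) (fun o => iteratedFDeriv ℝ 2 (φ o) x ![v, v])
    hli.coe_linearMap (fun j => iteratedFDeriv ℝ 2 (h j) x ![v, v]) (by
      intro w hw
      by_contra! hlt
      obtain ⟨c, hc, hc0⟩ := exists_curve_mem_zero_set hh hli hhx hhv hw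
      have hca : Tendsto c (𝓝 0) (𝓝 x) := by
        have h0 : Tendsto (fun t : ℝ => t ^ 2) (𝓝 0) (𝓝 0) := by
          simpa using (continuous_pow 2).tendsto (0 : ℝ)
        simpa using (hc.trans_tendsto h0).add (hasDerivAt_parabola x v w 0).continuousAt.tendsto
      have hcx : Tendsto c (𝓝[>] 0) (𝓝 x) := hca.mono_left nhdsWithin_le_nhds
      have hgc : ∀ᶠ t in 𝓝[>] 0, ∀ i, g i (c t) ≤ 0 := by
        refine eventually_all.2 fun i => ?_
        rcases (hgx i).lt_or_eq with hi | hi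
        · exact ((((hg i).continuous.tendsto x).comp hcx).eventually_lt_const hi).mono
            fun _ => le_of_lt
        · have hdesc : ∀ᶠ t in 𝓝[>] 0, g i (c t) < g i x := by
            refine (hg i).eventually_lt_along_curve hc ?_
            rcases (hgv i hi).lt_or_eq with hvi | hvi
            exacts [Or.inl hvi, Or.inr ⟨hvi, hlt (some ⟨i, hi, hvi⟩)⟩]
          exact hdesc.mono fun t ht => (ht.trans_eq hi).le
      have hfc : ∀ᶠ t in 𝓝[>] 0, f (c t) < f x :=
        hf.eventually_lt_along_curve hc (Or.inr ⟨hfv, hlt none⟩)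
      have hhc : ∀ᶠ t in 𝓝[>] (0 : ℝ), ∀ j, h j (c t) = 0 := nhdsWithin_le_nhds hc0
      obtain ⟨t, h1, h2, h3, h4⟩ := (hgc.and (hhc.and (hfc.and
        (hcx.eventually (eventually_nhdsWithin_iff.1 hmin))))).exists
      exact absurd (h4 ⟨h1, h2⟩) (not_le.2 h3))
  have hpos : 0 < t none := by
    refine (ht none).lt_of_ne' fun h0 => ?_
    obtain ⟨u, hgu, hhu⟩ := hu
    have hsum : ∑ i, t (some i) = 1 := by rw [← ht1, Fintype.sum_option, h0, zero_add]
    obtain ⟨i, -, hi⟩ := Finset.exists_ne_zero_of_sum_ne_zero (hsum.trans_ne one_ne_zero)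
    have hstatu := LinearMap.congr_fun hstat u
    simp only [Fintype.sum_option, h0, LinearMap.add_apply, LinearMap.sum_apply,
      LinearMap.smul_apply, ContinuousLinearMap.coe_coe, hhu, mul_zero, Finset.sum_const_zero,
      zero_smul, LinearMap.zero_apply, zero_add, add_zero, smul_eq_mul] at hstatu
    refine hstatu.not_lt (Finset.sum_neg' (fun i _ => ?_) ⟨i, Finset.mem_univ i, ?_⟩)
    · exact mul_nonpos_of_nonneg_of_nonpos (ht _) (hgu i i.2.1).le
    · exact mul_neg_of_pos_of_neg ((ht _).lt_of_ne' hi) (hgu i i.2.1)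
  let l : ι → ℝ := fun i => if hi : P i then (t none)⁻¹ * t (some ⟨i, hi⟩) else 0
  have hl (i : {i // P i}) : l i = (t none)⁻¹ * t (some i) := dif_pos i.2
  have hl0 (i : ι) (hi : i ∉ Set.range ((↑) : {i // P i} → ι)) : l i = 0 :=
    dif_neg fun hP => hi ⟨⟨i, hP⟩, rfl⟩
  refine ⟨l, fun j => (t none)⁻¹ * r j, fun i => ?_, fun i => ?_, ?_, ?_⟩
  · by_cases hi : P i
    · rw [hl ⟨i, hi⟩]
      exact mul_nonneg (inv_nonneg.2 hpos.le) (ht _)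
    · exact (show l i = 0 from dif_neg hi).ge
  · by_cases hi : P i
    · rw [hi.1, mul_zero]
    · rw [show l i = 0 from dif_neg hi, zero_mul]
  · rw [← Fintype.sum_of_injective _ Subtype.val_injective
      (fun i : {i // P i} => ((t none)⁻¹ * t (some i)) • fderiv ℝ (g i) x)
      (fun i => l i • fderiv ℝ (g i) x) (fun i hi => by rw [hl0 i hi, zero_smul])
      fun i => by rw [hl]]
    ext y
    have := LinearMap.congr_fun hstat y
    simp only [Fintype.sum_option, LinearMap.add_apply, LinearMap.sum_apply,
      LinearMap.smul_apply, ContinuousLinearMap.coe_coe, LinearMap.zero_apply,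
      smul_eq_mul] at this
    change t none * fderiv ℝ f x y + ∑ i : {i // P i}, t (some i) * fderiv ℝ (g i) x y + _ = 0
      at this
    simp only [_root_.add_apply, _root_.sum_apply,
      _root_.smul_apply, _root_.zero_apply, smul_eq_mul, mul_assoc,
      ← Finset.mul_sum]
    have hmul := congrArg ((t none)⁻¹ * ·) this
    simpa only [mul_add, inv_mul_cancel_left₀ hpos.ne', mul_zero] using hmul
  · rw [← Fintype.sum_of_injective _ Subtype.val_injective
      (fun i : {i // P i} => ((t none)⁻¹ * t (some i)) * iteratedFDeriv ℝ 2 (g i) x ![v, v])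
      (fun i => l i * iteratedFDeriv ℝ 2 (g i) x ![v, v])
      (fun i hi => by rw [hl0 i hi, zero_mul]) fun i => by rw [hl]]
    simp only [mul_assoc, ← Finset.mul_sum]
    rw [Fintype.sum_option] at hcurv
    change 0 ≤ t none * iteratedFDeriv ℝ 2 f x ![v, v] +
      ∑ i, t (some i) * iteratedFDeriv ℝ 2 (g i) x ![v, v] + _ at hcurv
    have hmul := mul_nonneg (inv_nonneg.2 hpos.le) hcurv
    simpa only [mul_add, inv_mul_cancel_left₀ hpos.ne'] using hmul

/-- Fritz John second-order necessary condition under MFCQ. -/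
theorem exists_multiplier_of_isLocalMinOn [CompleteSpace E]
    (hf : ContDiff ℝ 2 f) (hg : ∀ i, ContDiff ℝ 2 (g i)) (hh : ∀ j, ContDiff ℝ 2 (h j))
    (hgx : ∀ i, g i x ≤ 0) (hhx : ∀ j, h j x = 0)
    (hmin : IsLocalMinOn f {y | (∀ i, g i y ≤ 0) ∧ ∀ j, h j y = 0} x)
    (hli : LinearIndependent ℝ fun j => fderiv ℝ (h j) x)
    (hu : ∃ u, (∀ i, g i x = 0 → fderiv ℝ (g i) x u < 0) ∧ ∀ j, fderiv ℝ (h j) x u = 0)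
    {v : E} (hfv : fderiv ℝ f x v ≤ 0) (hgv : ∀ i, g i x = 0 → fderiv ℝ (g i) x v ≤ 0)
    (hhv : ∀ j, fderiv ℝ (h j) x v = 0) :
    ∃ (l : ι → ℝ) (r : κ → ℝ), (∀ i, 0 ≤ l i) ∧ (∀ i, l i * g i x = 0) ∧
      fderiv ℝ f x + ∑ i, l i • fderiv ℝ (g i) x + ∑ j, r j • fderiv ℝ (h j) x = 0 ∧
      0 ≤ iteratedFDeriv ℝ 2 f x ![v, v] + ∑ i, l i * iteratedFDeriv ℝ 2 (g i) x ![v, v] +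
        ∑ j, r j * iteratedFDeriv ℝ 2 (h j) x ![v, v] := by
  refine exists_multiplier_of_isLocalMinOn_of_fderiv_eq_zero hf hg hh hgx hhx hmin hli hu
    (hfv.antisymm ?_) hgv hhv
  obtain ⟨l, r, hl, hlg, hstat, -⟩ := exists_multiplier_of_isLocalMinOn_of_fderiv_eq_zero
    hf hg hh hgx hhx hmin hli hu (v := 0) (map_zero _) (fun _ _ => (map_zero _).le)
    fun _ => map_zero _
  have hstatv := DFunLike.congr_fun hstat v
  simp only [_root_.add_apply, _root_.sum_apply,
    _root_.smul_apply, _root_.zero_apply, smul_eq_mul, hhv, mul_zero,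
    Finset.sum_const_zero, add_zero] at hstatv
  have : ∑ i, l i * fderiv ℝ (g i) x v ≤ 0 := Finset.sum_nonpos fun i _ => by
    rcases mul_eq_zero.1 (hlg i) with hi | hi
    · rw [hi, zero_mul]
    · exact mul_nonpos_of_nonneg_of_nonpos (hl i) (hgv i hi)
  linarith

/-- Gauvin: under MFCQ the set of Lagrange multipliers is compact. -/
theorem isCompact_multipliers (f' : E →L[ℝ] ℝ) (g' : ι → E →L[ℝ] ℝ) {h' : κ → E →L[ℝ] ℝ}
    (γ : ι → ℝ) (hli : LinearIndependent ℝ h')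
    (hu : ∃ u, (∀ i, γ i = 0 → g' i u < 0) ∧ ∀ j, h' j u = 0) :
    IsCompact {lm : (ι → ℝ) × (κ → ℝ) | (∀ i, 0 ≤ lm.1 i) ∧ (∀ i, lm.1 i * γ i = 0) ∧
      f' + ∑ i, lm.1 i • g' i + ∑ j, lm.2 j • h' j = 0} := by
  classical
  obtain ⟨u, hgu, hhu⟩ := hu
  choose e he using fun j => hli.coe_linearMap.exists_forall_apply_eq (Pi.single j 1)
  have hbox : IsCompact (Set.univ.pi fun i => Set.Icc (0 : ℝ) |f' u / -g' i u|) :=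
    isCompact_univ_pi fun _ => isCompact_Icc
  refine (hbox.image (f := fun l => (l, fun j => -(f' (e j) + ∑ i, l i * g' i (e j))))
    (by fun_prop)).of_isClosed_subset ?_ ?_
  · simp only [Set.ofPred_and, Set.ofPred_forall]
    refine IsClosed.inter ?_ (IsClosed.inter ?_ ?_)
    · exact isClosed_iInter fun i => isClosed_le continuous_const (by fun_prop)
    · exact isClosed_iInter fun i => isClosed_eq (by fun_prop) continuous_const
    · exact isClosed_eq (by fun_prop) continuous_const
  · rintro ⟨l, r⟩ ⟨hl, hlγ, hstat⟩
    have happ (y : E) : f' y + ∑ i, l i * g' i y + ∑ j, r j * h' j y = 0 := by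
      simpa using DFunLike.congr_fun hstat y
    have hlg (i : ι) : 0 ≤ l i * -g' i u := by
      rcases mul_eq_zero.1 (hlγ i) with h0 | h0
      · rw [show l i = 0 from h0, zero_mul]
      · exact mul_nonneg (hl i) (neg_nonneg.2 (hgu i h0).le)
    refine ⟨l, fun i _ => ⟨hl i, ?_⟩, Prod.ext rfl (funext fun j => ?_)⟩
    · rcases mul_eq_zero.1 (hlγ i) with h0 | h0
      · rw [show l i = 0 from h0]
        exact abs_nonneg _
      · have h1 := happ u
        simp only [hhu, mul_zero, Finset.sum_const_zero, add_zero] at h1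
        have h2 := Finset.single_le_sum (fun i _ => hlg i) (Finset.mem_univ i)
        simp only [mul_neg, Finset.sum_neg_distrib] at h2
        refine le_trans ?_ (le_abs_self _)
        rw [le_div_iff₀ (neg_pos.2 (hgu i h0))]
        linarith
    · have h1 := happ (e j)
      have h2 : ∑ k, r k * h' k (e j) = r j := by
        have hek (k : κ) : h' k (e j) = (Pi.single j 1 : κ → ℝ) k := he j k
        simp [hek, Pi.single_apply]
      change -(f' (e j) + ∑ i, l i * g' i (e j)) = r j
      linarith

end Multipliers

end SecondOrder

theorem exists_nonneg_apply_of_range_eq_extremePoints {X ι : Type*} [AddCommGroup X] [Module ℝ X]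
    [TopologicalSpace X] [T2Space X] [IsTopologicalAddGroup X] [ContinuousSMul ℝ X]
    [LocallyConvexSpace ℝ X] [Finite ι] {S : Set X} (hS : IsCompact S) (hconv : Convex ℝ S)
    {vert : ι → X} (hvert : Set.range vert = S.extremePoints ℝ) (b : ℝ) (ℓ : X →ₗ[ℝ] ℝ) {x : X}
    (hx : x ∈ S) (h0 : 0 ≤ b + ℓ x) : ∃ i, 0 ≤ b + ℓ (vert i) := by
  by_contra! hneg
  have hhull : S = convexHull ℝ (Set.range vert) := by
    rw [← (Set.finite_range vert).isClosed_convexHull (𝕜 := ℝ) |>.closure_eq, hvert,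
      closure_convexHull_extremePoints hS hconv]
  have hsub : convexHull ℝ (Set.range vert) ⊆ {y | ℓ y < -b} :=
    convexHull_min (Set.range_subset_iff.2 fun i => by
      have := hneg i
      exact show ℓ (vert i) < -b by linarith) (convex_halfSpace_lt ℓ.isLinear _)
  have : ℓ x < -b := hsub (hhull ▸ hx)
  linarith

theorem convex_multipliers {M ι κ : Type*} [AddCommGroup M] [Module ℝ M] [Fintype ι] [Fintype κ]
    (f' : M) (g' : ι → M) (h' : κ → M) (γ : ι → ℝ) :
    Convex ℝ {lm : (ι → ℝ) × (κ → ℝ) | (∀ i, 0 ≤ lm.1 i) ∧ (∀ i, lm.1 i * γ i = 0) ∧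
      f' + ∑ i, lm.1 i • g' i + ∑ j, lm.2 j • h' j = 0} := by
  rintro ⟨l, r⟩ ⟨hl, hlγ, hstat⟩ ⟨l', r'⟩ ⟨hl', hlγ', hstat'⟩ a b ha hb hab
  refine ⟨fun i => add_nonneg (mul_nonneg ha (hl i)) (mul_nonneg hb (hl' i)), fun i => ?_, ?_⟩
  · change (a * l i + b * l' i) * γ i = 0
    linear_combination a * hlγ i + b * hlγ' i
  · have key : f' + ∑ i, (a * l i + b * l' i) • g' i + ∑ j, (a * r j + b * r' j) • h' j =
        a • (f' + ∑ i, l i • g' i + ∑ j, r j • h' j) +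
          b • (f' + ∑ i, l' i • g' i + ∑ j, r' j • h' j) := by
      simp only [add_smul, Finset.sum_add_distrib, mul_smul, ← Finset.smul_sum, smul_add]
      nth_rewrite 1 [← one_smul ℝ f']
      rw [← hab, add_smul]
      abel
    exact key.trans (by rw [hstat, hstat', smul_zero, smul_zero, add_zero])

theorem iteratedFDeriv_lagrangian {E ι κ : Type*} [NormedAddCommGroup E] [NormedSpace ℝ E]
    [Fintype ι] [Fintype κ] {k : ℕ} {f : E → ℝ} {g : ι → E → ℝ} {h : κ → E → ℝ}
    (hf : ContDiff ℝ k f) (hg : ∀ i, ContDiff ℝ k (g i)) (hh : ∀ j, ContDiff ℝ k (h j))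
    (l : ι → ℝ) (r : κ → ℝ) (x : E) (v : Fin k → E) :
    iteratedFDeriv ℝ k (fun y => f y + ∑ i, l i * g i y + ∑ j, r j * h j y) x v =
      iteratedFDeriv ℝ k f x v + ∑ i, l i * iteratedFDeriv ℝ k (g i) x v +
        ∑ j, r j * iteratedFDeriv ℝ k (h j) x v := by
  have hsmul {φ : E → ℝ} (hφ : ContDiff ℝ k φ) (c : ℝ) :
      iteratedFDeriv ℝ k (fun y => c * φ y) x = c • iteratedFDeriv ℝ k φ x :=
    iteratedFDeriv_const_smul_apply' (a := c) hφ.contDiffAt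
  have hg' (i : ι) : ContDiff ℝ k fun y => l i * g i y := contDiff_const.mul (hg i)
  have hh' (j : κ) : ContDiff ℝ k fun y => r j * h j y := contDiff_const.mul (hh j)
  have hgs : ContDiff ℝ k fun y => ∑ i, l i * g i y := ContDiff.sum fun i _ => hg' i
  have hhs : ContDiff ℝ k fun y => ∑ j, r j * h j y := ContDiff.sum fun j _ => hh' j
  rw [fun_iteratedFDeriv_add_apply (hf.add hgs).contDiffAt hhs.contDiffAt,
    fun_iteratedFDeriv_add_apply hf.contDiffAt hgs.contDiffAt,
    iteratedFDeriv_fun_sum_apply fun i _ => (hg' i).contDiffAt,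
    iteratedFDeriv_fun_sum_apply fun j _ => (hh' j).contDiffAt]
  simp [hsmul (hg _), hsmul (hh _)]

theorem Matrix.convex_range_quadratic_triple {n : ℕ} {A : Fin 3 → Matrix (Fin n) (Fin n) ℝ}
    (hA : ∀ j, (A j).IsSymm) {s : Fin 3 → ℝ} (hs : (∑ j, s j • A j).PosDef)
    {V : Submodule ℝ (Fin n → ℝ)} (hV : 3 ≤ Module.finrank ℝ V) :
    Convex ℝ (Set.range fun (v : V) j => (v : Fin n → ℝ) ⬝ᵥ A j *ᵥ v) := by
  have happ (j : Fin 3) (v w : V) : (Matrix.toBilin' (A j)).restrict V v w = v ⬝ᵥ A j *ᵥ w :=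
    Matrix.toBilin'_apply' (A j) (v : Fin n → ℝ) w
  convert _root_.convex_range_quadratic_triple hV
    (fun j => (Matrix.toBilin' (A j)).restrict V) (fun j => ?_) s fun v hv => ?_ using 1
  · ext y
    simp only [happ]
  · refine LinearMap.BilinForm.IsSymm.restrict ⟨fun v w => ?_⟩ V
    rw [Matrix.toBilin'_apply', Matrix.toBilin'_apply', dotProduct_comm, ← vecMul_transpose,
      hA j, ← dotProduct_mulVec]
  · have := hs.dotProduct_mulVec_pos (x := v) (by simpa using hv)
    simpa [Matrix.toBilin'_apply', sum_mulVec, dotProduct_sum, smul_mulVec] using this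

theorem second_order_necessary (n p q m : ℕ) (hm : 1 ≤ m)
    (f : (Fin n → ℝ) → ℝ) (g : Fin p → (Fin n → ℝ) → ℝ)
    (h : Fin q → (Fin n → ℝ) → ℝ)
    (hf : ContDiff ℝ 2 f) (hg : ∀ i, ContDiff ℝ 2 (g i))
    (hh : ∀ j, ContDiff ℝ 2 (h j))
    (xstar : Fin n → ℝ)
    (hfeas : (∀ i, g i xstar ≤ 0) ∧ (∀ j, h j xstar = 0))
    (hlocmin : IsLocalMinOn f {x | (∀ i, g i x ≤ 0) ∧ (∀ j, h j x = 0)} xstar)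
    -- MFCQ
    (hmfcq₁ : LinearIndependent ℝ (fun j => fderiv ℝ (h j) xstar))
    (hmfcq₂ : ∃ u : Fin n → ℝ, (∀ i, g i xstar = 0 → fderiv ℝ (g i) xstar u < 0) ∧
      (∀ j, fderiv ℝ (h j) xstar u = 0))
    -- Lagrange multiplier set
    (Λ : Set ((Fin p → ℝ) × (Fin q → ℝ)))
    (hΛ : Λ = {lm | (∀ i, 0 ≤ lm.1 i) ∧ (∀ i, lm.1 i * g i xstar = 0) ∧
      fderiv ℝ f xstar + ∑ i, lm.1 i • fderiv ℝ (g i) xstar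
        + ∑ j, lm.2 j • fderiv ℝ (h j) xstar = 0})
    -- Lagrangian
    (L : (Fin p → ℝ) × (Fin q → ℝ) → (Fin n → ℝ) → ℝ)
    (hL : L = fun lm x => f x + ∑ i, lm.1 i * g i x + ∑ j, lm.2 j * h j x)
    -- vertices of Λ
    (vert : Fin m → (Fin p → ℝ) × (Fin q → ℝ))
    (hvert : Set.range vert = Set.extremePoints ℝ Λ)
    -- Hessians generated by three matrices with a positive definite combination
    (A : Fin 3 → Matrix (Fin n) (Fin n) ℝ) (hAsym : ∀ j, (A j).IsSymm)
    (hs : ∃ s : Fin 3 → ℝ, (∑ j, s j • A j).PosDef)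
    (hgen : ∀ i : Fin m, ∃ r : Fin 3 → ℝ, ∀ v : Fin n → ℝ,
      iteratedFDeriv ℝ 2 (L (vert i)) xstar ![v, v] = v ⬝ᵥ (∑ j, r j • A j) *ᵥ v)
    -- regular cone inside the critical cone
    (K : Set (Fin n → ℝ)) (V : Submodule ℝ (Fin n → ℝ))
    (hKreg : K ∪ (-K) = (V : Set (Fin n → ℝ)))
    (hKdim : 3 ≤ Module.finrank ℝ (Submodule.span ℝ K))
    (hKsub : K ⊆ {v | fderiv ℝ f xstar v ≤ 0 ∧
      (∀ i, g i xstar = 0 → fderiv ℝ (g i) xstar v ≤ 0) ∧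
      (∀ j, fderiv ℝ (h j) xstar v = 0)}) :
    ∃ lm ∈ Λ, ∀ v ∈ K, 0 ≤ iteratedFDeriv ℝ 2 (L lm) xstar ![v, v] := by
  have hKV : K ⊆ V := hKreg ▸ Set.subset_union_left
  have hV : 3 ≤ Module.finrank ℝ V :=
    hKdim.trans (Submodule.finrank_mono (Submodule.span_le.2 hKV))
  have hΛcompact : IsCompact Λ :=
    hΛ ▸ isCompact_multipliers _ _ (fun i => g i xstar) hmfcq₁ hmfcq₂
  have hΛconv : Convex ℝ Λ := hΛ ▸ convex_multipliers _ _ _ fun i => g i xstar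
  let ℓ (v : Fin n → ℝ) : (Fin p → ℝ) × (Fin q → ℝ) →ₗ[ℝ] ℝ :=
    (Fintype.linearCombination ℝ fun i => iteratedFDeriv ℝ 2 (g i) xstar ![v, v]).coprod
      (Fintype.linearCombination ℝ fun j => iteratedFDeriv ℝ 2 (h j) xstar ![v, v])
  have hHess (lm : (Fin p → ℝ) × (Fin q → ℝ)) (v : Fin n → ℝ) :
      iteratedFDeriv ℝ 2 (L lm) xstar ![v, v] = iteratedFDeriv ℝ 2 f xstar ![v, v] + ℓ v lm := by
    rw [hL]
    exact (iteratedFDeriv_lagrangian hf hg hh lm.1 lm.2 xstar ![v, v]).trans (add_assoc _ _ _)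
  have hvertex : ∀ v ∈ K, ∃ i, 0 ≤ iteratedFDeriv ℝ 2 (L (vert i)) xstar ![v, v] := by
    intro v hv
    obtain ⟨hfv, hgv, hhv⟩ := hKsub hv
    obtain ⟨l, r, hl, hlg, hstat, hcurv⟩ :=
      exists_multiplier_of_isLocalMinOn hf hg hh hfeas.1 hfeas.2 hlocmin hmfcq₁ hmfcq₂ hfv hgv hhv
    simp only [hHess]
    refine exists_nonneg_apply_of_range_eq_extremePoints hΛcompact hΛconv hvert _ (ℓ v)
      (x := (l, r)) (hΛ ▸ ⟨hl, hlg, hstat⟩) ?_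
    exact hcurv.trans_eq (add_assoc _ _ _)
  obtain ⟨s, hs⟩ := hs
  choose r hr using hgen
  let T : (Fin 3 → ℝ) →ₗ[ℝ] Fin m → ℝ := Matrix.toLin' (Matrix.of r)
  have hT (v : Fin n → ℝ) (i : Fin m) :
      T (fun j => v ⬝ᵥ A j *ᵥ v) i = iteratedFDeriv ℝ 2 (L (vert i)) xstar ![v, v] := by
    rw [hr]
    simp only [sum_mulVec, dotProduct_sum, smul_mulVec, dotProduct_smul, smul_eq_mul]
    rfl
  obtain ⟨t, ht, ht1, hcomb⟩ := ((Matrix.convex_range_quadratic_triple hAsym hs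
      hV).linear_image T).exists_nonneg_weights ((Set.range_nonempty _).image T) (by
    rintro _ ⟨_, ⟨v, rfl⟩, rfl⟩
    simp only [hT]
    rcases hKreg.ge v.2 with hv | hv
    · exact hvertex v hv
    · obtain ⟨i, hi⟩ := hvertex _ hv
      refine ⟨i, ?_⟩
      rw [hr] at hi ⊢
      simpa [mulVec_neg] using hi)
  refine ⟨∑ i, t i • vert i, hΛconv.sum_mem (fun i _ => ht i) ht1 fun i _ =>
    extremePoints_subset (hvert ▸ Set.mem_range_self i), fun v hv => ?_⟩
  have hsum : iteratedFDeriv ℝ 2 (L (∑ i, t i • vert i)) xstar ![v, v] =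
      ∑ i, t i * iteratedFDeriv ℝ 2 (L (vert i)) xstar ![v, v] := by
    simp only [hHess, map_sum, map_smul, smul_eq_mul, mul_add, Finset.sum_add_distrib,
      ← Finset.sum_mul, ht1, one_mul]
  rw [hsum]
  simpa only [hT] using hcomb _ ⟨_, ⟨⟨v, hKV hv⟩, rfl⟩, rfl⟩
end
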